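/- arXiv:1302.4117 — 3 statements merged into one kernel-verified Lean document; each statement's English description precedes it below -/
import Mathlib

section
/- Let g : [1,∞) → (0,∞) be nonincreasing with g(x) → 0 as x → ∞, and suppose there is δ > 0 with g(x²) ≥ δ·g(x) for all x ≥ 1. Then there exists a Dirichlet series φ(s) = ∑_{n≥1} c_n n^{−s}, converging uniformly on ℂ_ε for every ε > 0 and with φ(ℂ₀) ⊂ ℂ_{1/2}, such that the composition operator C_φ is bounded and compact on ℋ² and there exist constants 0 < c ≤ C and N ≥ 1 with c·g(n) ≤ a_n(C_φ) ≤ C·g(n) for all n ≥ N. -/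
open Complex Filter MeasureTheory

noncomputable section

/-- The Hilbert space `ℋ²` of Dirichlet series with square-summable coefficients,
modeled by its coefficient sequences (indexed by `ℕ+`). -/
abbrev H2 := ↥(lp (fun _ : ℕ+ => ℂ) 2)

/-- The Dirichlet series attached to an element of `ℋ²`; it converges on `Re s > 1/2`. -/
noncomputable def H2series (x : H2) (s : ℂ) : ℂ := ∑' n : ℕ+, x n * (n : ℂ) ^ (-s)

/-- `T` is (the bounded operator realizing) the composition operator `C_φ` on `ℋ²`:
for every `f ∈ ℋ²`, the Dirichlet series of `T f` agrees with `f ∘ φ` on `ℂ_{1/2}`. -/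
def IsCompOp (φ : ℂ → ℂ) (T : H2 →L[ℂ] H2) : Prop :=
  ∀ (x : H2) (s : ℂ), 1 / 2 < s.re → H2series (T x) s = H2series x (φ s)

/-- The `n`-th approximation number of a bounded operator: the distance in operator
norm to the operators of rank `< n`. -/
noncomputable def approxNumber {E F : Type*} [NormedAddCommGroup E] [NormedSpace ℂ E]
    [NormedAddCommGroup F] [NormedSpace ℂ F] (T : E →L[ℂ] F) (n : ℕ) : ℝ :=
  sInf {c : ℝ | ∃ R : E →L[ℂ] F,
    FiniteDimensional ℂ (LinearMap.range (R : E →ₗ[ℂ] F)) ∧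
    Module.finrank ℂ (LinearMap.range (R : E →ₗ[ℂ] F)) < n ∧ c = ‖T - R‖}

/-- The Dirichlet series with coefficients `c` converges uniformly on `ℂ_ε = {Re s > ε}`
for every `ε > 0`, with sum `φ`. -/
def DSConvUnif (c : ℕ → ℂ) (φ : ℂ → ℂ) : Prop :=
  ∀ ε : ℝ, 0 < ε →
    TendstoUniformlyOn (fun N s => ∑ n ∈ Finset.range N, LSeries.term c s n) φ
      atTop {s : ℂ | ε < s.re}

lemma hasSum_sq_norm_circleAverage {f : ℂ → ℂ} {c : ℕ → ℂ}
    (hf : ∀ z : ℂ, ‖z‖ < 1 → HasSum (fun j => c j * z ^ j) (f z)) {r : ℝ} (hr0 : 0 ≤ r)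
    (hr1 : r < 1) :
    HasSum (fun j => ‖c j‖ ^ 2 * r ^ (2 * j))
      (Real.circleAverage (fun z => ‖f (r * z)‖ ^ 2) 0 1) := by
  have hrn : ‖(r : ℂ)‖ < 1 := by simpa [abs_of_nonneg hr0] using hr1
  have hsum : Summable fun j => ‖c j‖ * r ^ j := by
    have := (hf r hrn).summable.norm
    simpa [abs_of_nonneg hr0] using this
  set p : ℕ → Polynomial ℂ := fun n =>
    ∑ j ∈ Finset.range n, Polynomial.monomial j (c j * (r : ℂ) ^ j) with hp
  have hcoeff : ∀ n j, (p n).coeff j = if j < n then c j * (r : ℂ) ^ j else 0 := by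
    intro n j
    simp [hp, Polynomial.finsetSum_coeff, Polynomial.coeff_monomial]
  have heval : ∀ n z, (p n).eval z = ∑ j ∈ Finset.range n, c j * (r * z) ^ j := by
    intro n z
    simp [hp, Polynomial.eval_finsetSum, mul_pow, mul_assoc]
  have hpars : ∀ n, ∑ j ∈ Finset.range n, ‖c j‖ ^ 2 * r ^ (2 * j) =
      Real.circleAverage (fun θ ↦ ‖(p n).eval θ‖ ^ 2) 0 1 := by
    intro n
    rw [← Polynomial.sum_sq_norm_coeff_eq_circleAverage]
    symm
    have hsub : (p n).support ⊆ Finset.range n := by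
      intro j hj
      rw [Polynomial.mem_support_iff, hcoeff] at hj
      by_contra h
      exact hj (by simp_all)
    rw [Finset.sum_subset hsub (fun j _ hj => by
      rw [Polynomial.notMem_support_iff.1 hj]; simp)]
    refine Finset.sum_congr rfl fun j hj => ?_
    rw [hcoeff, if_pos (Finset.mem_range.1 hj)]
    simp [abs_of_nonneg hr0, mul_pow, pow_mul, pow_right_comm]
  rw [hasSum_iff_tendsto_nat_of_nonneg (fun j => by positivity)]
  simp_rw [hpars, Real.circleAverage_def]
  refine Tendsto.const_smul ?_ _
  have hnorm : ∀ θ : ℝ, ‖(r : ℂ) * circleMap 0 1 θ‖ = r := by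
    intro θ; simp [abs_of_nonneg hr0]
  refine intervalIntegral.tendsto_integral_filter_of_dominated_convergence
    (fun _ => (∑' j, ‖c j‖ * r ^ j) ^ 2) ?_ ?_ ?_ ?_
  · refine Eventually.of_forall fun n => Continuous.aestronglyMeasurable ?_
    fun_prop
  · refine Eventually.of_forall fun n => Eventually.of_forall fun θ _ => ?_
    rw [Real.norm_of_nonneg (by positivity)]
    refine pow_le_pow_left₀ (norm_nonneg _) ?_ 2
    rw [heval]
    refine (norm_sum_le _ _).trans ?_
    calc ∑ j ∈ Finset.range n, ‖c j * ((r : ℂ) * circleMap 0 1 θ) ^ j‖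
        = ∑ j ∈ Finset.range n, ‖c j‖ * r ^ j := by
          simp_rw [norm_mul, norm_pow, hnorm]
      _ ≤ _ := hsum.sum_le_tsum _ (fun j _ => by positivity)
  · exact intervalIntegrable_const
  · refine Eventually.of_forall fun θ _ => ?_
    have := (hf (r * circleMap 0 1 θ) (by rw [hnorm]; exact hr1)).tendsto_sum_nat
    simp_rw [heval]
    exact (this.norm.pow 2)

lemma hasSum_sq_norm_of_radial_limit {f : ℂ → ℂ} {c : ℕ → ℂ}
    (hf : ∀ z : ℂ, ‖z‖ < 1 → HasSum (fun j => c j * z ^ j) (f z))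
    (hcont : ContinuousOn f (Metric.ball 0 1))
    (hb : ∀ z : ℂ, ‖z‖ < 1 → ‖f z‖ ≤ 1) {G : ℝ → ℝ}
    (hG : ∀ᵐ θ : ℝ, Tendsto (fun r : ℝ => ‖f (r * circleMap 0 1 θ)‖ ^ 2)
      (nhdsWithin 1 (Set.Iio 1)) (nhds (G θ))) :
    HasSum (fun j => ‖c j‖ ^ 2) ((2 * Real.pi)⁻¹ * ∫ θ in (0 : ℝ)..(2 * Real.pi), G θ) := by
  set I := (2 * Real.pi)⁻¹ * ∫ θ in (0 : ℝ)..(2 * Real.pi), G θ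
  have hev : ∀ᶠ r : ℝ in nhdsWithin 1 (Set.Iio 1), 0 ≤ r ∧ r < 1 := by
    filter_upwards [self_mem_nhdsWithin,
      mem_nhdsWithin_of_mem_nhds (Ioi_mem_nhds (zero_lt_one' ℝ))] with r h1 h2
    exact ⟨le_of_lt h2, h1⟩
  have hlim : Tendsto (fun r : ℝ => Real.circleAverage (fun z => ‖f (r * z)‖ ^ 2) 0 1)
      (nhdsWithin 1 (Set.Iio 1)) (nhds I) := by
    simp_rw [Real.circleAverage_def, smul_eq_mul]
    refine Tendsto.const_mul _ ?_
    refine intervalIntegral.tendsto_integral_filter_of_dominated_convergence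
      (fun _ => 1) ?_ ?_ ?_ ?_
    · filter_upwards [hev] with r hr
      refine Continuous.aestronglyMeasurable ?_
      refine Continuous.pow (Continuous.norm ?_) 2
      refine hcont.comp_continuous (by fun_prop) fun θ => ?_
      simpa [abs_of_nonneg hr.1] using hr.2
    · filter_upwards [hev] with r hr
      refine Eventually.of_forall fun θ _ => ?_
      rw [Real.norm_of_nonneg (by positivity)]
      exact pow_le_one₀ (norm_nonneg _) (hb _ (by simpa [abs_of_nonneg hr.1] using hr.2))
    · exact intervalIntegrable_const
    · filter_upwards [hG] with θ hθ _ using hθ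
  have hfin : ∀ s : Finset ℕ, ∑ j ∈ s, ‖c j‖ ^ 2 ≤ I := by
    intro s
    have h1 : Tendsto (fun r : ℝ => ∑ j ∈ s, ‖c j‖ ^ 2 * r ^ (2 * j))
        (nhdsWithin 1 (Set.Iio 1)) (nhds (∑ j ∈ s, ‖c j‖ ^ 2 * 1 ^ (2 * j))) :=
      Tendsto.mono_left (Continuous.tendsto (by fun_prop) _) nhdsWithin_le_nhds
    simp only [one_pow, mul_one] at h1
    refine le_of_tendsto_of_tendsto h1 hlim ?_
    filter_upwards [hev] with r hr
    exact sum_le_hasSum s (fun j _ => mul_nonneg (by positivity) (pow_nonneg hr.1 _))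
      (hasSum_sq_norm_circleAverage hf hr.1 hr.2)
  have hs : Summable fun j => ‖c j‖ ^ 2 :=
    summable_of_sum_le (fun j => by positivity) hfin
  have hle : ∑' j, ‖c j‖ ^ 2 ≤ I := hs.tsum_le_of_sum_le hfin
  have hge : I ≤ ∑' j, ‖c j‖ ^ 2 := by
    refine le_of_tendsto hlim ?_
    filter_upwards [hev] with r hr
    refine hasSum_le (fun j => ?_) (hasSum_sq_norm_circleAverage hf hr.1 hr.2) hs.hasSum
    exact mul_le_of_le_one_right (by positivity) (pow_le_one₀ hr.1 hr.2.le)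
  rw [← le_antisymm hle hge]
  exact hs.hasSum

/-- The analytic function on the unit disc whose real part is the harmonic measure of the
lower half circle. -/
def halfCircleFun (z : ℂ) : ℂ := 1 / 2 + I / Real.pi * log ((1 + z) / (1 - z))

/-- The boundary values of the real part of `halfCircleFun`, as a function of the angle. -/
def lowerInd (θ : ℝ) : ℝ := if 0 < Real.sin θ then 0 else 1

lemma halfCircleFun_re (z : ℂ) :
    (halfCircleFun z).re = 1 / 2 - arg ((1 + z) / (1 - z)) / Real.pi := by
  have h : I / (Real.pi : ℂ) * log ((1 + z) / (1 - z)) =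
      ((1 / Real.pi : ℝ) : ℂ) * (I * log ((1 + z) / (1 - z))) := by
    push_cast; ring
  rw [halfCircleFun, add_re, h, re_ofReal_mul, I_mul_re, log_im]
  norm_num
  ring

lemma cayley_re (z : ℂ) : ((1 + z) / (1 - z)).re = (1 - normSq z) / normSq (1 - z) := by
  rw [div_re]
  simp [normSq_apply]
  ring

lemma cayley_im (z : ℂ) : ((1 + z) / (1 - z)).im = 2 * z.im / normSq (1 - z) := by
  rw [div_im]
  simp [normSq_apply]
  ring

lemma one_sub_ne_zero_of_norm_lt {z : ℂ} (hz : ‖z‖ < 1) : 1 - z ≠ 0 := by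
  intro h
  rw [sub_eq_zero] at h
  rw [← h] at hz
  simp at hz

lemma cayley_re_pos {z : ℂ} (hz : ‖z‖ < 1) : 0 < ((1 + z) / (1 - z)).re := by
  rw [cayley_re]
  refine div_pos ?_ (normSq_pos.2 (one_sub_ne_zero_of_norm_lt hz))
  rw [normSq_eq_norm_sq]
  nlinarith [norm_nonneg z]

lemma halfCircleFun_re_mem {z : ℂ} (hz : ‖z‖ < 1) :
    (halfCircleFun z).re ∈ Set.Icc (0 : ℝ) 1 := by
  rw [halfCircleFun_re]
  have h := (abs_arg_lt_pi_div_two_iff.2 (Or.inl (cayley_re_pos hz)))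
  rw [abs_lt] at h
  have hpi := Real.pi_pos
  have h1 : arg ((1 + z) / (1 - z)) / Real.pi < 1 / 2 := by
    rw [div_lt_iff₀ hpi]; linarith
  have h2 : -(1 / 2) < arg ((1 + z) / (1 - z)) / Real.pi := by
    rw [lt_div_iff₀ hpi]; linarith
  constructor <;> linarith

lemma differentiableAt_halfCircleFun {z : ℂ} (h1 : 1 - z ≠ 0)
    (h : (1 + z) / (1 - z) ∈ slitPlane) : DifferentiableAt ℂ halfCircleFun z := by
  unfold halfCircleFun
  refine (differentiableAt_const _).add ((differentiableAt_const _).mul ?_)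
  refine DifferentiableAt.clog ?_ h
  fun_prop (disch := assumption)

lemma differentiableOn_halfCircleFun : DifferentiableOn ℂ halfCircleFun (Metric.ball 0 1) := by
  intro z hz
  have hz : ‖z‖ < 1 := by simpa using hz
  exact (differentiableAt_halfCircleFun (one_sub_ne_zero_of_norm_lt hz)
    (Or.inl (cayley_re_pos hz))).differentiableWithinAt

lemma circleMap_zero_one_im (θ : ℝ) : (circleMap 0 1 θ).im = Real.sin θ := by
  simp [circleMap, exp_ofReal_mul_I_im]

lemma tendsto_halfCircleFun_re {θ : ℝ} (hθ : Real.sin θ ≠ 0) :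
    Tendsto (fun z => (halfCircleFun z).re) (nhds (circleMap 0 1 θ)) (nhds (lowerInd θ)) := by
  set z := circleMap 0 1 θ with hz
  have him : z.im = Real.sin θ := circleMap_zero_one_im θ
  have h1 : 1 - z ≠ 0 := by
    intro h
    have := congrArg Complex.im h
    simp [him] at this
    exact hθ this
  have hpos := normSq_pos.2 h1
  have hne : ((1 + z) / (1 - z)).im ≠ 0 := by
    rw [cayley_im, him]
    exact div_ne_zero (mul_ne_zero two_ne_zero hθ) hpos.ne'
  have hval : lowerInd θ = (halfCircleFun z).re := by
    have hre : ((1 + z) / (1 - z)).re = 0 := by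
      rw [cayley_re, normSq_eq_norm_sq, hz, norm_circleMap_zero]; simp
    rw [halfCircleFun_re, lowerInd]
    have hpi := Real.pi_ne_zero
    split_ifs with hs
    · have h2 : 0 < ((1 + z) / (1 - z)).im := by
        rw [cayley_im, him]; positivity
      rw [arg_eq_pi_div_two_iff.2 ⟨hre, h2⟩]
      field_simp
      norm_num
    · have h2 : ((1 + z) / (1 - z)).im < 0 := by
        rw [cayley_im, him]
        exact div_neg_of_neg_of_pos (by linarith [lt_of_le_of_ne (not_lt.1 hs) hθ]) hpos
      rw [arg_eq_neg_pi_div_two_iff.2 ⟨hre, h2⟩]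
      field_simp
      norm_num
  rw [hval]
  exact (continuous_re.continuousAt.comp
    (differentiableAt_halfCircleFun h1 (Or.inr hne)).continuousAt)

lemma ae_sin_two_pow_mul_ne_zero : ∀ᵐ θ : ℝ, ∀ b : ℕ, Real.sin (2 ^ b * θ) ≠ 0 := by
  rw [ae_all_iff]
  intro b
  have : {θ : ℝ | Real.sin (2 ^ b * θ) = 0} ⊆ Set.range fun n : ℤ => (n : ℝ) * Real.pi / 2 ^ b := by
    intro θ hθ
    obtain ⟨n, hn⟩ := Real.sin_eq_zero_iff.1 hθ
    exact ⟨n, by simp [hn]⟩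
  have := ((Set.countable_range _).mono this).measure_zero volume
  rw [ae_iff]
  simpa using this

lemma lowerInd_nonneg (θ : ℝ) : 0 ≤ lowerInd θ := by unfold lowerInd; split_ifs <;> simp

lemma lowerInd_le_one (θ : ℝ) : lowerInd θ ≤ 1 := by unfold lowerInd; split_ifs <;> simp

lemma measurable_lowerInd : Measurable lowerInd :=
  Measurable.ite (measurableSet_lt measurable_const Real.measurable_sin) measurable_const
    measurable_const

lemma lowerInd_add_two_pi (θ : ℝ) : lowerInd (θ + 2 * Real.pi) = lowerInd θ := by
  simp [lowerInd]

lemma lowerInd_two_pow_periodic (b : ℕ) :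
    Function.Periodic (fun θ => lowerInd (2 ^ b * θ)) (2 * Real.pi) := by
  intro θ
  have h : Function.Periodic lowerInd (2 * Real.pi) := lowerInd_add_two_pi
  have := h.nat_mul (2 ^ b) (2 ^ b * θ)
  simp only
  rw [← this]
  push_cast
  ring_nf

lemma intervalIntegrable_prod_exp (β : ℕ → ℝ) (hβ : ∀ b, 0 ≤ β b) (n : ℕ) (x y : ℝ) :
    IntervalIntegrable (fun θ => ∏ b ∈ Finset.range n, Real.exp (-β b * lowerInd (2 ^ b * θ)))
      volume x y := by
  refine IntervalIntegrable.mono_fun (intervalIntegrable_const (c := (1 : ℝ))) ?_ ?_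
  · refine Measurable.aestronglyMeasurable ?_
    refine Finset.measurable_prod _ fun b _ => ?_
    have := measurable_lowerInd
    fun_prop
  · refine Eventually.of_forall fun θ => ?_
    simp only
    rw [Real.norm_of_nonneg (by positivity), norm_one]
    refine Finset.prod_le_one (fun b _ => by positivity) fun b _ => ?_
    rw [Real.exp_le_one_iff]
    nlinarith [hβ b, lowerInd_nonneg (2 ^ b * θ)]

lemma integral_prod_exp_lowerInd (n : ℕ) : ∀ (β : ℕ → ℝ), (∀ b, 0 ≤ β b) →
    (2 * Real.pi)⁻¹ * ∫ θ in (0 : ℝ)..(2 * Real.pi),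
      ∏ b ∈ Finset.range n, Real.exp (-β b * lowerInd (2 ^ b * θ)) =
    ∏ b ∈ Finset.range n, (1 + Real.exp (-β b)) / 2 := by
  induction n with
  | zero =>
    intro β _
    have := Real.pi_pos
    simp
    field_simp
  | succ n ih =>
    intro β hβ
    have hpi := Real.pi_pos
    set G : ℝ → ℝ := fun x =>
      ∏ b ∈ Finset.range n, Real.exp (-β (b + 1) * lowerInd (2 ^ b * x)) with hG
    have hGper : Function.Periodic G (2 * Real.pi) := by
      intro θ
      simp only [hG]
      refine Finset.prod_congr rfl fun b _ => ?_
      have := lowerInd_two_pow_periodic b θ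
      simp only at this
      rw [this]
    have hGI : ∀ x y, IntervalIntegrable G volume x y := fun x y =>
      intervalIntegrable_prod_exp (fun b => β (b + 1)) (fun b => hβ _) n x y
    have hsplit : ∀ θ, ∏ b ∈ Finset.range (n + 1), Real.exp (-β b * lowerInd (2 ^ b * θ)) =
        Real.exp (-β 0 * lowerInd θ) * G (2 * θ) := by
      intro θ
      rw [Finset.prod_range_succ', mul_comm]
      simp only [hG, pow_zero, one_mul]
      congr 1
      refine Finset.prod_congr rfl fun b _ => ?_
      rw [pow_succ, mul_assoc]
    have hint := intervalIntegrable_prod_exp β hβ (n + 1)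
    rw [← intervalIntegral.integral_add_adjacent_intervals (hint 0 Real.pi)
      (hint Real.pi (2 * Real.pi))]
    simp_rw [hsplit]
    have e1 : ∫ θ in (0 : ℝ)..Real.pi, Real.exp (-β 0 * lowerInd θ) * G (2 * θ) =
        (1 / 2) * ∫ x in (0 : ℝ)..(2 * Real.pi), G x := by
      have h := intervalIntegral.integral_comp_mul_left G (two_ne_zero' ℝ) (a := 0)
        (b := Real.pi)
      rw [mul_zero, smul_eq_mul] at h
      rw [one_div, ← h]
      refine intervalIntegral.integral_congr_ae ?_
      filter_upwards [compl_mem_ae_iff.2 (measure_singleton Real.pi)] with θ hne hθ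
      rw [Set.uIoc_of_le hpi.le] at hθ
      have : 0 < Real.sin θ := Real.sin_pos_of_pos_of_lt_pi hθ.1 (lt_of_le_of_ne hθ.2 hne)
      simp [lowerInd, this]
    have e2 : ∫ θ in Real.pi..(2 * Real.pi), Real.exp (-β 0 * lowerInd θ) * G (2 * θ) =
        Real.exp (-β 0) * ((1 / 2) * ∫ x in (0 : ℝ)..(2 * Real.pi), G x) := by
      have h := intervalIntegral.integral_comp_mul_left G (two_ne_zero' ℝ) (a := Real.pi)
        (b := 2 * Real.pi)
      have hp := hGper.intervalIntegral_add_eq 0 (2 * Real.pi)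
      rw [zero_add, ← two_mul] at hp
      rw [← hp, smul_eq_mul] at h
      rw [one_div, ← h, ← intervalIntegral.integral_const_mul]
      refine intervalIntegral.integral_congr fun θ hθ => ?_
      rw [Set.uIcc_of_le (by linarith)] at hθ
      have : ¬ 0 < Real.sin θ := by
        rw [← Real.sin_sub_two_pi, not_lt]
        exact Real.sin_nonpos_of_nonpos_of_neg_pi_le (by linarith [hθ.2]) (by linarith [hθ.1])
      simp [lowerInd, this]
    have := ih (fun b => β (b + 1)) fun b => hβ _
    rw [e1, e2, Finset.prod_range_succ', ← this]
    ring

/-- The analytic function on the unit disc whose real part has boundary values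
`∑ α b * lowerInd (2 ^ b * θ)`. -/
def lacunaryFun (α : ℕ → ℝ) (z : ℂ) : ℂ := ∑' b, (α b : ℂ) * halfCircleFun (z ^ 2 ^ b)

lemma norm_pow_two_pow_lt_one {z : ℂ} (hz : ‖z‖ < 1) (b : ℕ) : ‖z ^ 2 ^ b‖ < 1 := by
  rw [norm_pow]
  exact pow_lt_one₀ (norm_nonneg _) hz (by positivity)

lemma exists_lacunaryFun_bound {α : ℕ → ℝ} (hα : ∀ b, 0 ≤ α b) {r : ℝ}
    (hr1 : r < 1) : ∃ C : ℝ, ∀ (b : ℕ) (z : ℂ), ‖z‖ ≤ r →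
      ‖(α b : ℂ) * halfCircleFun (z ^ 2 ^ b)‖ ≤ α b * C := by
  have hsub : Metric.closedBall (0 : ℂ) r ⊆ Metric.ball 0 1 :=
    Metric.closedBall_subset_ball hr1
  obtain ⟨C, hC⟩ := (isCompact_closedBall (0 : ℂ) r).exists_bound_of_continuousOn
    (differentiableOn_halfCircleFun.continuousOn.mono hsub)
  refine ⟨C, fun b z hz => ?_⟩
  rw [norm_mul, norm_real, Real.norm_of_nonneg (hα b)]
  refine mul_le_mul_of_nonneg_left (hC _ ?_) (hα b)
  rw [mem_closedBall_zero_iff, norm_pow]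
  exact (pow_le_of_le_one (norm_nonneg _) (hz.trans hr1.le) (by positivity)).trans hz

lemma summable_lacunaryFun {α : ℕ → ℝ} (hα : ∀ b, 0 ≤ α b) (hs : Summable α) {z : ℂ}
    (hz : ‖z‖ < 1) : Summable fun b => (α b : ℂ) * halfCircleFun (z ^ 2 ^ b) := by
  obtain ⟨C, hC⟩ := exists_lacunaryFun_bound hα hz
  exact Summable.of_norm_bounded (hs.mul_right C) fun b => hC b z le_rfl

lemma differentiableOn_lacunaryFun {α : ℕ → ℝ} (hα : ∀ b, 0 ≤ α b) (hs : Summable α) :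
    DifferentiableOn ℂ (lacunaryFun α) (Metric.ball 0 1) := by
  intro z hz
  have hz : ‖z‖ < 1 := by simpa using hz
  set r := (1 + ‖z‖) / 2 with hr
  have hr1 : r < 1 := by linarith
  have hzr : ‖z‖ < r := by linarith
  obtain ⟨C, hC⟩ := exists_lacunaryFun_bound hα hr1
  have hd : DifferentiableOn ℂ (lacunaryFun α) (Metric.ball 0 r) := by
    refine differentiableOn_tsum_of_summable_norm (hs.mul_right C) (fun b => ?_)
      Metric.isOpen_ball fun b w hw => hC b w (by simpa using (mem_ball_zero_iff.1 hw).le)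
    refine DifferentiableOn.const_mul ?_ _
    refine differentiableOn_halfCircleFun.comp (by fun_prop) fun w hw => ?_
    rw [mem_ball_zero_iff] at hw ⊢
    exact norm_pow_two_pow_lt_one (hw.trans hr1) b
  exact (hd.differentiableAt (Metric.isOpen_ball.mem_nhds (by simpa using hzr))).differentiableWithinAt

lemma lacunaryFun_re {α : ℕ → ℝ} (hα : ∀ b, 0 ≤ α b) (hs : Summable α) {z : ℂ}
    (hz : ‖z‖ < 1) :
    (lacunaryFun α z).re = ∑' b, α b * (halfCircleFun (z ^ 2 ^ b)).re := by
  rw [lacunaryFun, re_tsum (summable_lacunaryFun hα hs hz)]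
  simp

lemma lacunaryFun_re_nonneg {α : ℕ → ℝ} (hα : ∀ b, 0 ≤ α b) (hs : Summable α) {z : ℂ}
    (hz : ‖z‖ < 1) : 0 ≤ (lacunaryFun α z).re := by
  rw [lacunaryFun_re hα hs hz]
  exact tsum_nonneg fun b => mul_nonneg (hα b)
    (halfCircleFun_re_mem (norm_pow_two_pow_lt_one hz b)).1

lemma tendsto_lacunaryFun_re {α : ℕ → ℝ} (hα : ∀ b, 0 ≤ α b) (hs : Summable α) {θ : ℝ}
    (hθ : ∀ b : ℕ, Real.sin (2 ^ b * θ) ≠ 0) :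
    Tendsto (fun r : ℝ => (lacunaryFun α (r * circleMap 0 1 θ)).re)
      (nhdsWithin 1 (Set.Iio 1)) (nhds (∑' b, α b * lowerInd (2 ^ b * θ))) := by
  have hev : ∀ᶠ r : ℝ in nhdsWithin 1 (Set.Iio 1), ‖(r : ℂ) * circleMap 0 1 θ‖ < 1 := by
    filter_upwards [self_mem_nhdsWithin,
      mem_nhdsWithin_of_mem_nhds (Ioi_mem_nhds (zero_lt_one' ℝ))] with r h1 h2
    simpa [abs_of_pos (Set.mem_Ioi.1 h2)] using h1
  have hlim : Tendsto (fun r : ℝ =>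
      ∑' b, α b * (halfCircleFun ((r * circleMap 0 1 θ) ^ 2 ^ b)).re)
      (nhdsWithin 1 (Set.Iio 1)) (nhds (∑' b, α b * lowerInd (2 ^ b * θ))) := by
    refine tendsto_tsum_of_dominated_convergence hs (fun b => ?_) ?_
    · refine Tendsto.const_mul _ ((tendsto_halfCircleFun_re (hθ b)).comp ?_)
      have h1 : circleMap 0 1 (2 ^ b * θ) = (((1 : ℝ) : ℂ) * circleMap 0 1 θ) ^ 2 ^ b := by
        simp [circleMap, ← Complex.exp_nat_mul]
        ring_nf
      rw [h1]
      exact Tendsto.mono_left (Continuous.tendsto (by fun_prop) _) nhdsWithin_le_nhds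
    · filter_upwards [hev] with r hr b
      have := halfCircleFun_re_mem (norm_pow_two_pow_lt_one hr b)
      rw [norm_mul, Real.norm_of_nonneg (hα b), Real.norm_of_nonneg this.1]
      exact mul_le_of_le_one_right (hα b) this.2
  refine hlim.congr' ?_
  filter_upwards [hev] with r hr
  exact (lacunaryFun_re hα hs hr).symm

theorem exists_disc_function {α : ℕ → ℝ} (hα : ∀ b, 0 ≤ α b) (hs : Summable α) :
    ∃ (F : ℂ → ℂ) (c : ℕ → ℕ → ℂ), (∀ z, ‖z‖ < 1 → ‖F z‖ ≤ 1) ∧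
      (∀ k z, ‖z‖ < 1 → HasSum (fun j => c k j * z ^ j) (F z ^ k)) ∧
      ∀ k : ℕ, Summable (fun j => ‖c k j‖ ^ 2) ∧
        ∀ n : ℕ, (1 / 2) ^ n * Real.exp (-(2 * k * ∑' b, α (b + n))) ≤ ∑' j, ‖c k j‖ ^ 2 ∧
          ∑' j, ‖c k j‖ ^ 2 ≤ ∏ b ∈ Finset.range n, (1 + Real.exp (-(2 * k * α b))) / 2 := by
  set F : ℂ → ℂ := fun z => exp (-lacunaryFun α z) with hF
  have hdiff : DifferentiableOn ℂ F (Metric.ball 0 1) :=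
    (differentiableOn_lacunaryFun hα hs).neg.cexp
  have hbound : ∀ z, ‖z‖ < 1 → ‖F z‖ ≤ 1 := by
    intro z hz
    simp only [hF, norm_exp, neg_re, Real.exp_le_one_iff]
    linarith [lacunaryFun_re_nonneg hα hs hz]
  set c : ℕ → ℕ → ℂ := fun k j => (j.factorial : ℂ)⁻¹ * iteratedDeriv j (F ^ k) 0
  have hser : ∀ k z, ‖z‖ < 1 → HasSum (fun j => c k j * z ^ j) (F z ^ k) := by
    intro k z hz
    have := Complex.hasSum_taylorSeries_on_ball (hdiff.pow k) (z := z) (by simpa using hz)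
    simpa [c, mul_assoc, mul_comm, mul_left_comm] using this
  refine ⟨F, c, hbound, hser, fun k => ?_⟩
  set G : ℝ → ℝ := fun θ => Real.exp (-(2 * k * ∑' b, α b * lowerInd (2 ^ b * θ))) with hG
  have hsum : ∀ θ : ℝ, Summable fun b => α b * lowerInd (2 ^ b * θ) := fun θ =>
    Summable.of_nonneg_of_le (fun b => mul_nonneg (hα b) (lowerInd_nonneg _))
      (fun b => mul_le_of_le_one_right (hα b) (lowerInd_le_one _)) hs
  have hmeas : Measurable G := by
    have hm : Measurable fun θ : ℝ => ∑' b, α b * lowerInd (2 ^ b * θ) := by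
      refine Measurable.tsum fun b => ?_
      have := measurable_lowerInd
      fun_prop
    fun_prop
  have hGint : IntervalIntegrable G volume 0 (2 * Real.pi) := by
    refine IntervalIntegrable.mono_fun (intervalIntegrable_const (c := (1 : ℝ)))
      hmeas.aestronglyMeasurable (Eventually.of_forall fun θ => ?_)
    simp only [hG, norm_one]
    rw [Real.norm_of_nonneg (by positivity), Real.exp_le_one_iff]
    have : 0 ≤ ∑' b, α b * lowerInd (2 ^ b * θ) :=
      tsum_nonneg fun b => mul_nonneg (hα b) (lowerInd_nonneg _)
    have : 0 ≤ 2 * (k : ℝ) * ∑' b, α b * lowerInd (2 ^ b * θ) := by positivity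
    linarith
  have hmain := hasSum_sq_norm_of_radial_limit (hser k) (hdiff.pow k).continuousOn
    (fun z hz => by rw [norm_pow]; exact pow_le_one₀ (norm_nonneg _) (hbound z hz))
    (G := G) (by
      filter_upwards [ae_sin_two_pow_mul_ne_zero] with θ hθ
      have h1 := tendsto_lacunaryFun_re hα hs hθ
      have h2 := (Real.continuous_exp.tendsto _).comp ((h1.const_mul (2 * (k : ℝ))).neg)
      refine h2.congr fun r => ?_
      simp only [Function.comp, hF, norm_pow, norm_exp, neg_re]
      rw [← Real.exp_nat_mul, ← Real.exp_nat_mul]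
      push_cast
      ring_nf)
  refine ⟨hmain.summable, fun n => ?_⟩
  rw [hmain.tsum_eq]
  set β : ℕ → ℝ := fun b => 2 * k * α b with hβ
  have hβ0 : ∀ b, 0 ≤ β b := fun b => mul_nonneg (by positivity) (hα b)
  have hpi := Real.pi_pos
  have hprod := integral_prod_exp_lowerInd n β hβ0
  have hPint := intervalIntegrable_prod_exp β hβ0 n 0 (2 * Real.pi)
  have hPeq : ∀ θ : ℝ, ∏ b ∈ Finset.range n, Real.exp (-β b * lowerInd (2 ^ b * θ)) =
      Real.exp (-(2 * k * ∑ b ∈ Finset.range n, α b * lowerInd (2 ^ b * θ))) := by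
    intro θ
    rw [← Real.exp_sum, Finset.mul_sum, ← Finset.sum_neg_distrib]
    congr 1
    refine Finset.sum_congr rfl fun b _ => ?_
    simp only [hβ]; ring
  have hsplit : ∀ θ : ℝ, ∑' b, α b * lowerInd (2 ^ b * θ) =
      ∑ b ∈ Finset.range n, α b * lowerInd (2 ^ b * θ) +
        ∑' b, α (b + n) * lowerInd (2 ^ (b + n) * θ) := fun θ =>
    ((hsum θ).sum_add_tsum_nat_add n).symm
  constructor
  · have h1 : (1 / 2 : ℝ) ^ n ≤ ∏ b ∈ Finset.range n, (1 + Real.exp (-β b)) / 2 := by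
      rw [← Finset.card_range n, ← Finset.prod_const, Finset.card_range]
      refine Finset.prod_le_prod (fun b _ => by positivity) fun b _ => ?_
      have := Real.exp_pos (-β b)
      linarith
    calc (1 / 2 : ℝ) ^ n * Real.exp (-(2 * k * ∑' b, α (b + n)))
        ≤ (∏ b ∈ Finset.range n, (1 + Real.exp (-β b)) / 2) *
            Real.exp (-(2 * k * ∑' b, α (b + n))) := by gcongr
      _ = (2 * Real.pi)⁻¹ * ∫ θ in (0 : ℝ)..(2 * Real.pi),
            (∏ b ∈ Finset.range n, Real.exp (-β b * lowerInd (2 ^ b * θ))) *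
            Real.exp (-(2 * k * ∑' b, α (b + n))) := by
          rw [intervalIntegral.integral_mul_const, ← hprod]; ring
      _ ≤ _ := by
          refine mul_le_mul_of_nonneg_left ?_ (by positivity)
          refine intervalIntegral.integral_mono_on (by positivity) (hPint.mul_const _) hGint ?_
          intro θ _
          rw [hPeq, ← Real.exp_add, hG]
          simp only
          rw [Real.exp_le_exp, hsplit]
          have : ∑' b, α (b + n) * lowerInd (2 ^ (b + n) * θ) ≤ ∑' b, α (b + n) :=
            Summable.tsum_le_tsum (fun b => mul_le_of_le_one_right (hα _) (lowerInd_le_one _))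
              ((summable_nat_add_iff n).2 (hsum θ)) ((summable_nat_add_iff n).2 hs)
          have := mul_le_mul_of_nonneg_left this (by positivity : (0 : ℝ) ≤ 2 * k)
          linarith
  · simp only [hβ] at hprod
    rw [← hprod]
    refine mul_le_mul_of_nonneg_left ?_ (by positivity)
    refine intervalIntegral.integral_mono_on (by positivity) hGint hPint ?_
    intro θ _
    have := hPeq θ
    simp only [hβ] at this
    rw [this, hG]
    simp only
    rw [Real.exp_le_exp, hsplit]
    have : 0 ≤ ∑' b, α (b + n) * lowerInd (2 ^ (b + n) * θ) :=
      tsum_nonneg fun b => mul_nonneg (hα _) (lowerInd_nonneg _)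
    have := mul_nonneg (by positivity : (0 : ℝ) ≤ 2 * k) this
    linarith

lemma exists_lower_bound_sq_mul {g : ℝ → ℝ} (hpos : ∀ x : ℝ, 1 ≤ x → 0 < g x)
    (hmono : AntitoneOn g (Set.Ici 1)) {δ : ℝ} (hδ : 0 < δ)
    (hsq : ∀ x : ℝ, 1 ≤ x → δ * g x ≤ g (x ^ 2)) :
    ∃ c : ℝ, 0 < c ∧ ∀ x : ℝ, 1 ≤ x → c ≤ g x ^ 2 * x := by
  set y : ℝ := max 2 (1 / δ ^ 2) with hy
  have hy2 : 2 ≤ y := le_max_left _ _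
  have hyδ : 1 ≤ δ ^ 2 * y := by
    have : 1 / δ ^ 2 ≤ y := le_max_right _ _
    rwa [div_le_iff₀ (by positivity), mul_comm] at this
  have hyy : 1 ≤ y ^ 2 := by nlinarith
  have hgy := hpos (y ^ 2) hyy
  have base : ∀ x : ℝ, 1 ≤ x → x ≤ y ^ 2 → g (y ^ 2) ^ 2 ≤ g x ^ 2 * x := by
    intro x h1 h2
    have h3 : g (y ^ 2) ≤ g x := hmono h1 hyy h2
    calc g (y ^ 2) ^ 2 ≤ g x ^ 2 := pow_le_pow_left₀ hgy.le h3 2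
      _ ≤ g x ^ 2 * x := le_mul_of_one_le_right (by positivity) h1
  have key : ∀ i : ℕ, ∀ x : ℝ, 1 ≤ x → x ≤ y ^ 2 ^ i → g (y ^ 2) ^ 2 ≤ g x ^ 2 * x := by
    intro i
    induction i with
    | zero => intro x h1 h2; exact base x h1 (by simp at h2; nlinarith)
    | succ i ih =>
      intro x h1 h2
      rcases le_total x (y ^ 2) with h | h
      · exact base x h1 h
      · set t := Real.sqrt x with ht
        have hxt : x = t ^ 2 := (Real.sq_sqrt (by linarith)).symm
        have hty : y ≤ t := Real.le_sqrt_of_sq_le h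
        have ht1 : 1 ≤ t := by linarith
        have htle : t ≤ y ^ 2 ^ i := by
          rw [ht, Real.sqrt_le_left (by positivity), ← pow_mul, ← pow_succ]
          exact h2
        refine (ih t ht1 htle).trans ?_
        have h4 := hsq t ht1
        rw [← hxt] at h4
        have h5 : (δ * g t) ^ 2 ≤ g x ^ 2 :=
          pow_le_pow_left₀ (mul_pos hδ (hpos t ht1)).le h4 2
        have h6 : 1 ≤ δ ^ 2 * t := hyδ.trans (by gcongr)
        calc g t ^ 2 * t ≤ g t ^ 2 * t * (δ ^ 2 * t) :=
              le_mul_of_one_le_right (by positivity) h6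
          _ = (δ * g t) ^ 2 * t ^ 2 := by ring
          _ ≤ g x ^ 2 * t ^ 2 := by gcongr
          _ = g x ^ 2 * x := by rw [← hxt]
  refine ⟨g (y ^ 2) ^ 2, by positivity, fun x hx => ?_⟩
  obtain ⟨n, hn⟩ := pow_unbounded_of_one_lt x (by linarith : 1 < y)
  exact key n x hx (hn.le.trans (pow_le_pow_right₀ (by linarith) Nat.lt_two_pow_self.le))

lemma mul_pow_le_of_sq {g : ℝ → ℝ} {δ : ℝ} (hδ : 0 < δ)
    (hsq : ∀ x : ℝ, 1 ≤ x → δ * g x ≤ g (x ^ 2)) (p : ℕ) :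
    ∀ x : ℝ, 1 ≤ x → δ ^ p * g x ≤ g (x ^ 2 ^ p) := by
  induction p with
  | zero => intro x _; simp
  | succ p ih =>
    intro x hx
    have h1 := hsq (x ^ 2 ^ p) (one_le_pow₀ hx)
    calc δ ^ (p + 1) * g x = δ * (δ ^ p * g x) := by ring
      _ ≤ δ * g (x ^ 2 ^ p) := by gcongr; exact ih x hx
      _ ≤ _ := by rw [pow_succ, pow_mul]; exact h1

lemma exp_neg_le_inv {x : ℝ} (hx : 0 < x) : Real.exp (-x) ≤ x⁻¹ := by
  rw [Real.exp_neg]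
  exact inv_anti₀ hx (by linarith [Real.add_one_le_exp x])

theorem exists_weights {g : ℝ → ℝ} (hpos : ∀ x : ℝ, 1 ≤ x → 0 < g x)
    (hmono : AntitoneOn g (Set.Ici 1)) (hlim : Tendsto g atTop (nhds 0))
    {δ : ℝ} (hδ : 0 < δ) (hsq : ∀ x : ℝ, 1 ≤ x → δ * g x ≤ g (x ^ 2)) :
    ∃ α : ℕ → ℝ, (∀ b, 0 ≤ α b) ∧ Summable α ∧ ∃ cl Cu : ℝ, 0 < cl ∧ 0 < Cu ∧
      ∀ k : ℕ, 4 ≤ k →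
        (∃ n : ℕ, cl * g k ^ 2 ≤ (1 / 2) ^ n * Real.exp (-(2 * k * ∑' b, α (b + n)))) ∧
        ∃ n : ℕ, ∏ b ∈ Finset.range n, (1 + Real.exp (-(2 * k * α b))) / 2 ≤ Cu * g k ^ 2 := by
  have hg1 := hpos 1 le_rfl
  set G : ℕ → ℝ := fun k => g 1 ^ 2 / g k ^ 2 with hG
  have hgk : ∀ k : ℕ, 1 ≤ k → 0 < g k := fun k hk => hpos k (by exact_mod_cast hk)
  have hGmono : ∀ k l : ℕ, 1 ≤ k → k ≤ l → G k ≤ G l := by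
    intro k l hk hkl
    have h1 : g l ≤ g k := hmono (by simpa using hk) (by simpa using hk.trans hkl)
      (by exact_mod_cast hkl)
    have := hgk l (hk.trans hkl)
    simp only [hG]
    gcongr
  have hG1 : ∀ k : ℕ, 1 ≤ k → 1 ≤ G k := by
    intro k hk
    have := hGmono 1 k le_rfl hk
    refine le_trans ?_ this
    simp only [hG, Nat.cast_one]
    rw [div_self (by positivity)]
  have hdyadic : ∀ k : ℕ, 1 ≤ k → ∃ n : ℕ, (2 : ℝ) ^ n ≤ G k ∧ G k < 2 ^ (n + 1) :=
    fun k hk => exists_nat_pow_near (hG1 k hk) one_lt_two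
  have hex : ∀ b : ℕ, ∃ x : ℕ, 1 ≤ x ∧ (2 : ℝ) ^ (b + 1) ≤ G x := by
    intro b
    have h1 : Tendsto (fun k : ℕ => g k) atTop (nhds 0) := hlim.comp tendsto_natCast_atTop_atTop
    have h2 : ∀ᶠ k : ℕ in atTop, g k < g 1 / 2 ^ (b + 1) :=
      h1.eventually_lt_const (by positivity)
    obtain ⟨k, hk, hk1⟩ := (h2.and (eventually_ge_atTop 1)).exists
    refine ⟨k, hk1, ?_⟩
    have hk0 := hgk k hk1
    simp only [hG]
    rw [le_div_iff₀ (by positivity)]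
    rw [lt_div_iff₀ (by positivity)] at hk
    have h3 : (1 : ℝ) ≤ 2 ^ (b + 1) := one_le_pow₀ one_le_two
    calc (2 : ℝ) ^ (b + 1) * g k ^ 2 ≤ 2 ^ (b + 1) * (2 ^ (b + 1) * g k ^ 2) :=
          le_mul_of_one_le_left (by positivity) h3 |>.trans (by ring_nf; rfl)
      _ = (g k * 2 ^ (b + 1)) ^ 2 := by ring
      _ ≤ g 1 ^ 2 := pow_le_pow_left₀ (by positivity) hk.le 2
  classical
  set K : ℕ → ℕ := fun b => Nat.find (hex b) with hK
  have hK1 : ∀ b, 1 ≤ K b := fun b => (Nat.find_spec (hex b)).1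
  have hKle : ∀ b k, 1 ≤ k → (2 : ℝ) ^ (b + 1) ≤ G k → K b ≤ k := fun b k hk h =>
    Nat.find_min' (hex b) ⟨hk, h⟩
  have hKspec : ∀ b k, 1 ≤ k → K b ≤ k → (2 : ℝ) ^ (b + 1) ≤ G k := fun b k hk h =>
    (Nat.find_spec (hex b)).2.trans (hGmono _ _ (hK1 b) h)
  set α : ℕ → ℝ := fun b => (1 / 2) ^ b / K b with hα
  have hKpos : ∀ b, (0 : ℝ) < K b := fun b => by exact_mod_cast hK1 b
  have hα0 : ∀ b, 0 ≤ α b := fun b => by have := hKpos b; positivity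
  have hgeo : Summable fun b : ℕ => (1 / 2 : ℝ) ^ b := summable_geometric_two
  have hαs : Summable α := Summable.of_nonneg_of_le hα0 (fun b => by
    have : (1 : ℝ) ≤ K b := by exact_mod_cast hK1 b
    exact div_le_self (by positivity) this) hgeo
  obtain ⟨c, hc, hgrow⟩ := exists_lower_bound_sq_mul hpos hmono hδ hsq
  set C := g 1 ^ 2 / c with hC
  have hGgrow : ∀ k : ℕ, 1 ≤ k → G k ≤ C * k := by
    intro k hk
    have := hgrow k (by exact_mod_cast hk)
    have := hgk k hk
    simp only [hG, hC]
    rw [div_mul_eq_mul_div, div_le_div_iff₀ (by positivity) hc]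
    calc g 1 ^ 2 * c ≤ g 1 ^ 2 * (g k ^ 2 * k) := by gcongr
      _ = _ := by ring
  refine ⟨α, hα0, hαs, Real.exp (-4) / g 1 ^ 2, 2 * Real.exp (C / 2) / g 1 ^ 2 / (δ ^ 2) ^ 2,
    by positivity, by positivity, fun k hk => ⟨?_, ?_⟩⟩
  · obtain ⟨n, hn1, hn2⟩ := hdyadic k (by omega)
    refine ⟨n, ?_⟩
    have hk0 := hgk k (by omega)
    have hkpos : (0 : ℝ) < k := by exact_mod_cast (by omega : 0 < k)
    have hterm : ∀ b, α (b + n) ≤ (1 / 2) ^ b * (1 / k : ℝ) := by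
      intro b
      have h1 : k ≤ K (b + n) := by
        by_contra! h
        have h2 := hKspec (b + n) k (by omega) h.le
        have h3 : (2 : ℝ) ^ (n + 1) ≤ 2 ^ (b + n + 1) :=
          pow_le_pow_right₀ one_le_two (by omega)
        linarith
      have h2 : (k : ℝ) ≤ K (b + n) := by exact_mod_cast h1
      simp only [hα]
      rw [mul_one_div]
      gcongr ?_ / ?_
      exact pow_le_pow_of_le_one (by norm_num) (by norm_num) (by omega)
    have hts : ∑' b, α (b + n) ≤ 2 * (1 / k : ℝ) := by
      rw [← tsum_geometric_two, ← tsum_mul_right]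
      exact Summable.tsum_le_tsum hterm ((summable_nat_add_iff n).2 hαs) (hgeo.mul_right _)
    have h4 : 2 * (k : ℝ) * ∑' b, α (b + n) ≤ 4 := by
      calc 2 * (k : ℝ) * ∑' b, α (b + n) ≤ 2 * (k : ℝ) * (2 * (1 / k : ℝ)) := by gcongr
        _ = 4 := by field_simp; norm_num
    calc Real.exp (-4) / g 1 ^ 2 * g k ^ 2 = (G k)⁻¹ * Real.exp (-4) := by
          simp only [hG]; rw [inv_div]; ring
      _ ≤ ((2 : ℝ) ^ n)⁻¹ * Real.exp (-(2 * k * ∑' b, α (b + n))) := by gcongr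
      _ = _ := by simp
  · set r := Nat.sqrt k with hr
    have hr2 : 2 ≤ r := by rw [hr, Nat.le_sqrt]; omega
    have hrk : r * r ≤ k := Nat.sqrt_le k
    have hkr : k ≤ r ^ 4 := by
      have h1 : k < (r + 1) * (r + 1) := Nat.lt_succ_sqrt k
      have h2 : r + 1 ≤ r * r := by nlinarith
      calc k ≤ (r + 1) * (r + 1) := h1.le
        _ ≤ (r * r) * (r * r) := Nat.mul_le_mul h2 h2
        _ = r ^ 4 := by ring
    have hrpos : (0 : ℝ) < r := by exact_mod_cast (by omega : 0 < r)
    obtain ⟨n, hn1, hn2⟩ := hdyadic r (by omega)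
    refine ⟨n, ?_⟩
    have hgr := hgk r (by omega)
    have hexp : ∀ b ∈ Finset.range n, Real.exp (-(2 * k * α b)) ≤ 2 ^ b * (1 / (2 * r) : ℝ) := by
      intro b hb
      have hbn := Finset.mem_range.1 hb
      have h1 : K b ≤ r := hKle b r (by omega)
        ((pow_le_pow_right₀ one_le_two (by omega)).trans hn1)
      have h1' : (K b : ℝ) ≤ r := by exact_mod_cast h1
      have hrk' : (r : ℝ) * r ≤ k := by exact_mod_cast hrk
      have hKb := hKpos b
      have h2 : 2 * (r : ℝ) / 2 ^ b ≤ 2 * k * α b := by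
        simp only [hα]
        calc 2 * (r : ℝ) / 2 ^ b = 2 * (r * r) * ((1 / 2) ^ b / r) := by
              rw [one_div, inv_pow]; field_simp
          _ ≤ 2 * k * ((1 / 2) ^ b / K b) := by gcongr
      calc Real.exp (-(2 * k * α b)) ≤ Real.exp (-(2 * (r : ℝ) / 2 ^ b)) := by gcongr
        _ ≤ (2 * (r : ℝ) / 2 ^ b)⁻¹ := exp_neg_le_inv (by positivity)
        _ = _ := by rw [inv_div]; ring
    have hsum : ∑ b ∈ Finset.range n, Real.exp (-(2 * k * α b)) ≤ C / 2 := by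
      calc ∑ b ∈ Finset.range n, Real.exp (-(2 * k * α b))
          ≤ ∑ b ∈ Finset.range n, 2 ^ b * (1 / (2 * r) : ℝ) := Finset.sum_le_sum hexp
        _ = (2 ^ n - 1) * (1 / (2 * r) : ℝ) := by
            rw [← Finset.sum_mul, geom_sum_eq (by norm_num)]; norm_num
        _ ≤ C * r * (1 / (2 * r) : ℝ) := by
            gcongr
            linarith [hGgrow r (by omega)]
        _ = C / 2 := by field_simp
    have hgrk : δ ^ 2 * g r ≤ g k := by
      have h1 := mul_pow_le_of_sq hδ hsq 2 r (by exact_mod_cast (by omega : 1 ≤ r))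
      refine h1.trans (hmono (by simpa using (by omega : 1 ≤ k)) ?_ ?_)
      · simp only [Set.mem_Ici]
        exact one_le_pow₀ (by exact_mod_cast (by omega : 1 ≤ r))
      · norm_num
        exact_mod_cast hkr
    calc ∏ b ∈ Finset.range n, (1 + Real.exp (-(2 * k * α b))) / 2
        = (∏ b ∈ Finset.range n, (1 + Real.exp (-(2 * k * α b)))) / 2 ^ n := by
          rw [Finset.prod_div_distrib]; simp
      _ ≤ (∏ b ∈ Finset.range n, Real.exp (Real.exp (-(2 * k * α b)))) / 2 ^ n := by
          gcongr with b _
          rw [add_comm]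
          exact Real.add_one_le_exp _
      _ = Real.exp (∑ b ∈ Finset.range n, Real.exp (-(2 * k * α b))) / 2 ^ n := by
          rw [Real.exp_sum]
      _ ≤ Real.exp (C / 2) / (G r / 2) := by
          gcongr
          rw [div_le_iff₀ two_pos, ← pow_succ]
          exact hn2.le
      _ = 2 * Real.exp (C / 2) / g 1 ^ 2 / (δ ^ 2) ^ 2 * (δ ^ 2 * g r) ^ 2 := by
          simp only [hG]; field_simp
      _ ≤ _ := by gcongr

lemma hasDerivAt_inv_mul_sum_log (k : ℕ) {x : ℝ} (hx : 0 < x) :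
    HasDerivAt (fun x : ℝ => x⁻¹ * ∑ j ∈ Finset.range (k + 1), Real.log x ^ j / j.factorial)
      (-(Real.log x ^ k / k.factorial * (x ^ 2)⁻¹)) x := by
  induction k with
  | zero => simpa using hasDerivAt_inv hx.ne'
  | succ k ih =>
    have hl := (((Real.hasDerivAt_log hx.ne').pow (k + 1)).div_const
      ((k + 1).factorial : ℝ)).const_mul (1 : ℝ)
    have h2 := (hasDerivAt_inv hx.ne').mul hl
    have h := ih.add h2
    have hfun : (fun x : ℝ => x⁻¹ * ∑ j ∈ Finset.range (k + 1 + 1), Real.log x ^ j / j.factorial) =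
        fun x => x⁻¹ * ∑ j ∈ Finset.range (k + 1), Real.log x ^ j / j.factorial +
          x⁻¹ * (1 * (Real.log x ^ (k + 1) / (k + 1).factorial)) := by
      funext y
      rw [Finset.sum_range_succ _ (k + 1)]
      ring
    rw [hfun]
    refine h.congr_deriv ?_
    have hk : ((k + 1).factorial : ℝ) = (k + 1) * k.factorial := by
      push_cast [Nat.factorial_succ]; ring
    have h0 : (k.factorial : ℝ) ≠ 0 := by positivity
    have h1 : ((k : ℝ) + 1) ≠ 0 := by positivity
    simp only [hk, Pi.pow_apply]
    push_cast
    field_simp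
    simp

lemma sum_range_log_pow_div_le (k N : ℕ) :
    ∑ n ∈ Finset.range N, Real.log ((n + 1 : ℕ) : ℝ) ^ k / k.factorial / ((n + 1 : ℕ) : ℝ) ^ 2
      ≤ 4 := by
  set Q : ℝ → ℝ := fun x => x⁻¹ * ∑ j ∈ Finset.range (k + 1), Real.log x ^ j / j.factorial
    with hQ
  have hstep : ∀ n : ℕ, Real.log ((n + 1 : ℕ) : ℝ) ^ k / k.factorial / ((n + 1 : ℕ) : ℝ) ^ 2 ≤
      4 * Q ((n + 1 : ℕ) : ℝ) - 4 * Q ((n + 1 + 1 : ℕ) : ℝ) := by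
    intro n
    have hn : (1 : ℝ) ≤ ((n + 1 : ℕ) : ℝ) := by push_cast; linarith [n.cast_nonneg (α := ℝ)]
    have hlt : ((n + 1 : ℕ) : ℝ) < ((n + 1 + 1 : ℕ) : ℝ) := by push_cast; linarith
    obtain ⟨ξ, hξ, he⟩ := exists_hasDerivAt_eq_slope Q
      (fun x => -(Real.log x ^ k / k.factorial * (x ^ 2)⁻¹)) hlt
      (fun x hx => (hasDerivAt_inv_mul_sum_log k (by linarith [hx.1])).continuousAt.continuousWithinAt)
      (fun x hx => hasDerivAt_inv_mul_sum_log k (by linarith [hx.1]))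
    have h1 : ((n + 1 + 1 : ℕ) : ℝ) - ((n + 1 : ℕ) : ℝ) = 1 := by push_cast; ring
    rw [h1, div_one] at he
    have hξ1 := hξ.1
    have hξ2 : ξ ≤ 2 * ((n + 1 : ℕ) : ℝ) := by linarith [hξ.2]
    have hlog : Real.log ((n + 1 : ℕ) : ℝ) ^ k ≤ Real.log ξ ^ k :=
      pow_le_pow_left₀ (Real.log_nonneg hn) (Real.log_le_log (by linarith) hξ1.le) k
    have hinv : 1 / ((n + 1 : ℕ) : ℝ) ^ 2 ≤ 4 * (ξ ^ 2)⁻¹ := by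
      have hξ0 : 0 < ξ := by linarith
      rw [← div_eq_mul_inv, div_le_div_iff₀ (by positivity) (by positivity)]
      nlinarith
    have hQ' : 4 * Q ((n + 1 : ℕ) : ℝ) - 4 * Q ((n + 1 + 1 : ℕ) : ℝ) =
      Real.log ξ ^ k / k.factorial * (4 * (ξ ^ 2)⁻¹) := by linarith
    rw [hQ', div_eq_mul_one_div _ (((n + 1 : ℕ) : ℝ) ^ 2)]
    have : 0 ≤ Real.log ξ ^ k := le_trans (pow_nonneg (Real.log_nonneg hn) k) hlog
    gcongr
  calc _ ≤ ∑ n ∈ Finset.range N, (4 * Q ((n + 1 : ℕ) : ℝ) - 4 * Q ((n + 1 + 1 : ℕ) : ℝ)) :=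
        Finset.sum_le_sum fun n _ => hstep n
    _ = 4 * Q ((0 + 1 : ℕ) : ℝ) - 4 * Q ((N + 1 : ℕ) : ℝ) :=
        Finset.sum_range_sub' (fun n : ℕ => 4 * Q ((n + 1 : ℕ) : ℝ)) N
    _ ≤ 4 := by
      have h1 : Q ((0 + 1 : ℕ) : ℝ) = 1 := by
        simp [hQ, Finset.sum_range_succ']
      have h2 : 0 ≤ Q ((N + 1 : ℕ) : ℝ) := by
        refine mul_nonneg (by positivity) (Finset.sum_nonneg fun j _ => ?_)
        have : 0 ≤ Real.log ((N + 1 : ℕ) : ℝ) := Real.log_natCast_nonneg _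
        positivity
      rw [h1]; linarith

/-- The Poisson-type weight `(log n)^k / k!`. -/
def logWeight (k : ℕ) (n : ℕ+) : ℝ := Real.log (n : ℝ) ^ k / k.factorial

lemma logWeight_nonneg (k : ℕ) (n : ℕ+) : 0 ≤ logWeight k n := by
  have : 0 ≤ Real.log (n : ℝ) := Real.log_natCast_nonneg _
  unfold logWeight; positivity

lemma sum_logWeight_div_sq_le (k : ℕ) (S : Finset ℕ+) :
    ∑ n ∈ S, logWeight k n / (n : ℝ) ^ 2 ≤ 4 := by
  classical
  let f : ℕ → ℝ := fun n =>
    Real.log ((n + 1 : ℕ) : ℝ) ^ k / k.factorial / ((n + 1 : ℕ) : ℝ) ^ 2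
  have hf : ∀ n, 0 ≤ f n := fun n => by
    have : 0 ≤ Real.log ((n + 1 : ℕ) : ℝ) := Real.log_natCast_nonneg _
    positivity
  have hsum : Summable f := summable_of_sum_range_le hf (sum_range_log_pow_div_le k)
  have hinj : Function.Injective PNat.natPred := PNat.natPred_injective
  calc ∑ n ∈ S, logWeight k n / (n : ℝ) ^ 2 = ∑ m ∈ S.image PNat.natPred, f m := by
        rw [Finset.sum_image fun a _ b _ h => hinj h]
        refine Finset.sum_congr rfl fun n _ => ?_
        simp only [f, PNat.natPred_add_one, logWeight]
    _ ≤ ∑' m, f m := hsum.sum_le_tsum _ fun m _ => hf m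
    _ ≤ 4 := hsum.tsum_le_of_sum_range_le (sum_range_log_pow_div_le k)

lemma summable_logWeight_div_sq (k : ℕ) : Summable fun n : ℕ+ => logWeight k n / (n : ℝ) ^ 2 :=
  summable_of_sum_le (fun n => div_nonneg (logWeight_nonneg k n) (by positivity))
    (sum_logWeight_div_sq_le k)

lemma hasSum_logWeight (n : ℕ+) : HasSum (fun k => logWeight k n) (n : ℝ) := by
  have h := NormedSpace.expSeries_div_hasSum_exp (𝔸 := ℝ) (Real.log (n : ℝ))
  rw [← Real.exp_eq_exp_ℝ, Real.exp_log (by exact_mod_cast n.pos)] at h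
  exact h

lemma hasSum_sub_sq_mul_pow_div_factorial (u : ℝ) :
    HasSum (fun k : ℕ => ((k : ℝ) - u) ^ 2 * (u ^ k / k.factorial)) (u * Real.exp u) := by
  have h0 : HasSum (fun k : ℕ => u ^ k / k.factorial) (Real.exp u) := by
    have h := NormedSpace.expSeries_div_hasSum_exp (𝔸 := ℝ) u
    rwa [← Real.exp_eq_exp_ℝ] at h
  have h1 : HasSum (fun k : ℕ => (k : ℝ) * (u ^ k / k.factorial)) (u * Real.exp u) := by
    rw [← hasSum_nat_add_iff' 1]
    simp only [Finset.range_one, Finset.sum_singleton, Nat.cast_zero, zero_mul, sub_zero]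
    refine (h0.mul_left u).congr_fun fun k => ?_
    push_cast [Nat.factorial_succ]
    field_simp
    ring
  have h2 : HasSum (fun k : ℕ => (k : ℝ) ^ 2 * (u ^ k / k.factorial))
      ((u * Real.exp u + Real.exp u) * u) := by
    rw [← hasSum_nat_add_iff' 1]
    simp only [Finset.range_one, Finset.sum_singleton, Nat.cast_zero, ne_eq, OfNat.ofNat_ne_zero,
      not_false_eq_true, zero_pow, zero_mul, sub_zero]
    refine ((h1.add h0).mul_right u).congr_fun fun k => ?_
    push_cast [Nat.factorial_succ]
    field_simp
    ring
  rw [show u * Real.exp u = (u * Real.exp u + Real.exp u) * u - 2 * u * (u * Real.exp u) +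
    u ^ 2 * Real.exp u by ring]
  refine ((h2.sub (h1.mul_left (2 * u))).add (h0.mul_left (u ^ 2))).congr_fun fun k => ?_
  ring

/-- Chebyshev's inequality for the Poisson weights. -/
lemma sum_logWeight_le_of_dist (n : ℕ+) {d : ℝ} (hd : 0 < d) (S : Finset ℕ)
    (hS : ∀ k ∈ S, d ≤ |(k : ℝ) - Real.log n|) :
    ∑ k ∈ S, logWeight k n ≤ n * (Real.log n / d ^ 2) := by
  have h := hasSum_sub_sq_mul_pow_div_factorial (Real.log n)
  rw [Real.exp_log (by exact_mod_cast n.pos)] at h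
  have h1 : ∑ k ∈ S, d ^ 2 * logWeight k n ≤ Real.log n * n := by
    rw [← h.tsum_eq]
    refine le_trans (Finset.sum_le_sum fun k hk => ?_)
      (h.summable.sum_le_tsum S fun k _ => mul_nonneg (sq_nonneg _) (logWeight_nonneg k n))
    refine mul_le_mul_of_nonneg_right ?_ (logWeight_nonneg k n)
    rw [← sq_abs ((k : ℝ) - Real.log n)]
    exact pow_le_pow_left₀ hd.le (hS k hk) 2
  rw [← Finset.mul_sum] at h1
  rw [mul_div_assoc', le_div_iff₀ (by positivity)]
  linarith

lemma summable_mul_of_summable_sq {ι : Type*} {f g : ι → ℝ} (hf0 : ∀ i, 0 ≤ f i)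
    (hg0 : ∀ i, 0 ≤ g i) (hf : Summable fun i => f i ^ 2) (hg : Summable fun i => g i ^ 2) :
    Summable fun i => f i * g i :=
  Summable.of_nonneg_of_le (fun i => mul_nonneg (hf0 i) (hg0 i))
    (fun i => by nlinarith [sq_nonneg (f i - g i), sq_nonneg (f i), sq_nonneg (g i)]) (hf.add hg)

lemma tsum_mul_sq_le {ι : Type*} {f g : ι → ℝ} (hf0 : ∀ i, 0 ≤ f i)
    (hg0 : ∀ i, 0 ≤ g i) (hf : Summable fun i => f i ^ 2) (hg : Summable fun i => g i ^ 2) :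
    (∑' i, f i * g i) ^ 2 ≤ (∑' i, f i ^ 2) * ∑' i, g i ^ 2 := by
  have h := summable_mul_of_summable_sq hf0 hg0 hf hg
  refine le_of_tendsto (h.hasSum.pow 2) (Eventually.of_forall fun S => ?_)
  refine (Finset.sum_mul_sq_le_sq_mul_sq S f g).trans ?_
  exact mul_le_mul (hf.sum_le_tsum S fun i _ => sq_nonneg _)
    (hg.sum_le_tsum S fun i _ => sq_nonneg _) (Finset.sum_nonneg fun i _ => sq_nonneg _)
    (tsum_nonneg fun i => sq_nonneg _)

lemma H2_hasSum_norm_sq (x : H2) : HasSum (fun n => ‖x n‖ ^ 2) (‖x‖ ^ 2) := by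
  have h := lp.hasSum_norm (p := 2) (by norm_num) x
  simpa using h

/-- The probability `(log n)^k / (k! n)` of `k` under the Poisson law of mean `log n`. -/
def poissonWeight (k : ℕ) (n : ℕ+) : ℝ := logWeight k n / n

lemma poissonWeight_nonneg (k : ℕ) (n : ℕ+) : 0 ≤ poissonWeight k n :=
  div_nonneg (logWeight_nonneg k n) (by positivity)

lemma hasSum_poissonWeight (n : ℕ+) : HasSum (fun k => poissonWeight k n) 1 := by
  have hn : (n : ℝ) ≠ 0 := by exact_mod_cast n.ne_zero
  simpa [poissonWeight, hn] using (hasSum_logWeight n).div_const (n : ℝ)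

lemma sum_poissonWeight_le_one (n : ℕ+) (S : Finset ℕ) : ∑ k ∈ S, poissonWeight k n ≤ 1 := by
  rw [← (hasSum_poissonWeight n).tsum_eq]
  exact (hasSum_poissonWeight n).summable.sum_le_tsum S fun k _ => poissonWeight_nonneg k n

lemma poissonWeight_le_one (k : ℕ) (n : ℕ+) : poissonWeight k n ≤ 1 := by
  simpa using sum_poissonWeight_le_one n {k}

lemma sum_poissonWeight_le_of_dist (n : ℕ+) {d : ℝ} (hd : 0 < d) (S : Finset ℕ)
    (hS : ∀ k ∈ S, d ≤ |(k : ℝ) - Real.log n|) :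
    ∑ k ∈ S, poissonWeight k n ≤ Real.log n / d ^ 2 := by
  have hn : (0 : ℝ) < n := by exact_mod_cast n.pos
  have h := sum_logWeight_le_of_dist n hd S hS
  unfold poissonWeight
  rw [← Finset.sum_div, div_le_iff₀ hn]
  linarith

lemma summable_poissonWeight_div (k : ℕ) : Summable fun n : ℕ+ => poissonWeight k n / n := by
  refine (summable_logWeight_div_sq k).congr fun n => ?_
  rw [poissonWeight, div_div, sq]

lemma tsum_poissonWeight_div_le (k : ℕ) : ∑' n : ℕ+, poissonWeight k n / n ≤ 4 := by
  refine Real.tsum_le_of_sum_le (fun n => div_nonneg (poissonWeight_nonneg k n) (by positivity))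
    fun S => le_trans (le_of_eq ?_) (sum_logWeight_div_sq_le k S)
  refine Finset.sum_congr rfl fun n _ => ?_
  rw [poissonWeight, div_div, sq]

/-- The coefficient of `w ^ k` in the Taylor expansion of `H2series x (3 / 2 - w)`. -/
def logCoef (k : ℕ) (x : H2) : ℂ := ∑' n : ℕ+, x n * ((poissonWeight k n / √(n : ℝ) : ℝ) : ℂ)

lemma summable_poissonWeight_mul_norm_sq (k : ℕ) (x : H2) :
    Summable fun n => poissonWeight k n * ‖x n‖ ^ 2 :=
  Summable.of_nonneg_of_le (fun n => mul_nonneg (poissonWeight_nonneg k n) (sq_nonneg _))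
    (fun n => mul_le_of_le_one_left (sq_nonneg _) (poissonWeight_le_one k n))
    (H2_hasSum_norm_sq x).summable

lemma sq_sqrt_poissonWeight_mul (k : ℕ) (x : H2) (n : ℕ+) :
    (√(poissonWeight k n) * ‖x n‖) ^ 2 = poissonWeight k n * ‖x n‖ ^ 2 := by
  rw [mul_pow, Real.sq_sqrt (poissonWeight_nonneg k n)]

lemma sq_sqrt_poissonWeight_div (k : ℕ) (n : ℕ+) :
    (√(poissonWeight k n) / √(n : ℝ)) ^ 2 = poissonWeight k n / n := by
  rw [div_pow, Real.sq_sqrt (poissonWeight_nonneg k n), Real.sq_sqrt (by positivity)]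

lemma norm_logCoef_term (k : ℕ) (x : H2) (n : ℕ+) :
    ‖x n * ((poissonWeight k n / √(n : ℝ) : ℝ) : ℂ)‖ =
      √(poissonWeight k n) / √(n : ℝ) * (√(poissonWeight k n) * ‖x n‖) := by
  have h0 : 0 ≤ poissonWeight k n / √(n : ℝ) := div_nonneg (poissonWeight_nonneg k n) (by positivity)
  rw [norm_mul, Complex.norm_real, Real.norm_of_nonneg h0]
  nth_rw 1 [← Real.mul_self_sqrt (poissonWeight_nonneg k n)]
  ring

lemma summable_norm_logCoef_term (k : ℕ) (x : H2) :
    Summable fun n => ‖x n * ((poissonWeight k n / √(n : ℝ) : ℝ) : ℂ)‖ := by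
  simp_rw [norm_logCoef_term]
  refine summable_mul_of_summable_sq (fun n => by positivity) (fun n => by positivity) ?_ ?_
  · simpa only [sq_sqrt_poissonWeight_div] using summable_poissonWeight_div k
  · simpa only [sq_sqrt_poissonWeight_mul] using summable_poissonWeight_mul_norm_sq k x

lemma norm_logCoef_sq_le (k : ℕ) (x : H2) :
    ‖logCoef k x‖ ^ 2 ≤ 4 * ∑' n, poissonWeight k n * ‖x n‖ ^ 2 := by
  have h1 : ‖logCoef k x‖ ≤ _ := norm_tsum_le_tsum_norm (summable_norm_logCoef_term k x)
  simp_rw [norm_logCoef_term] at h1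
  refine (pow_le_pow_left₀ (norm_nonneg _) h1 2).trans ?_
  refine (tsum_mul_sq_le (fun n => by positivity) (fun n => by positivity) ?_ ?_).trans ?_
  · simpa only [sq_sqrt_poissonWeight_div] using summable_poissonWeight_div k
  · simpa only [sq_sqrt_poissonWeight_mul] using summable_poissonWeight_mul_norm_sq k x
  simp only [sq_sqrt_poissonWeight_div, sq_sqrt_poissonWeight_mul]
  exact mul_le_mul_of_nonneg_right (tsum_poissonWeight_div_le k)
    (tsum_nonneg fun n => mul_nonneg (poissonWeight_nonneg k n) (sq_nonneg _))

lemma sum_norm_logCoef_sq_le (S : Finset ℕ) (x : H2) :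
    ∑ k ∈ S, ‖logCoef k x‖ ^ 2 ≤ 4 * ‖x‖ ^ 2 := by
  calc ∑ k ∈ S, ‖logCoef k x‖ ^ 2 ≤ ∑ k ∈ S, 4 * ∑' n, poissonWeight k n * ‖x n‖ ^ 2 :=
        Finset.sum_le_sum fun k _ => norm_logCoef_sq_le k x
    _ = 4 * ∑' n, ∑ k ∈ S, poissonWeight k n * ‖x n‖ ^ 2 := by
        rw [← Finset.mul_sum, Summable.tsum_finsetSum fun k _ =>
          summable_poissonWeight_mul_norm_sq k x]
    _ ≤ 4 * ‖x‖ ^ 2 := by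
        rw [← (H2_hasSum_norm_sq x).tsum_eq]
        refine mul_le_mul_of_nonneg_left ?_ (by norm_num)
        refine Summable.tsum_le_tsum (fun n => ?_)
          (summable_sum fun k _ => summable_poissonWeight_mul_norm_sq k x)
          (H2_hasSum_norm_sq x).summable
        rw [← Finset.sum_mul]
        exact mul_le_of_le_one_left (sq_nonneg _) (sum_poissonWeight_le_one n S)

lemma summable_norm_logCoef_sq (x : H2) : Summable fun k => ‖logCoef k x‖ ^ 2 :=
  summable_of_sum_le (fun _ => sq_nonneg _) fun S => sum_norm_logCoef_sq_le S x

lemma norm_logCoef_le (k : ℕ) (x : H2) : ‖logCoef k x‖ ≤ 2 * ‖x‖ := by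
  have h := sum_norm_logCoef_sq_le {k} x
  rw [Finset.sum_singleton] at h
  nlinarith [norm_nonneg (logCoef k x), norm_nonneg x]

lemma logCoef_add (k : ℕ) (x y : H2) : logCoef k (x + y) = logCoef k x + logCoef k y := by
  unfold logCoef
  rw [← Summable.tsum_add (summable_norm_logCoef_term k x).of_norm
    (summable_norm_logCoef_term k y).of_norm]
  refine tsum_congr fun n => ?_
  rw [lp.coeFn_add, Pi.add_apply, add_mul]

lemma logCoef_smul (k : ℕ) (a : ℂ) (x : H2) : logCoef k (a • x) = a * logCoef k x := by
  unfold logCoef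
  rw [← tsum_mul_left]
  refine tsum_congr fun n => ?_
  rw [lp.coeFn_smul, Pi.smul_apply, smul_eq_mul, mul_assoc]

lemma hasSum_poissonWeight_mul_pow (n : ℕ+) (w : ℂ) :
    HasSum (fun k => (poissonWeight k n / √(n : ℝ) : ℝ) * w ^ k) ((n : ℂ) ^ (-(3 / 2 - w))) := by
  have hn : (n : ℂ) ≠ 0 := by exact_mod_cast n.ne_zero
  have hn' : (0 : ℝ) < n := by exact_mod_cast n.pos
  have h := NormedSpace.expSeries_div_hasSum_exp (𝔸 := ℂ) ((Real.log (n : ℝ) : ℂ) * w)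
  rw [← Complex.exp_eq_exp_ℂ] at h
  have h2 := h.mul_left (((n : ℝ)⁻¹ * (√(n : ℝ))⁻¹ : ℝ) : ℂ)
  have hE : ((n : ℂ) ^ (-(3 / 2 - w))) =
      (((n : ℝ)⁻¹ * (√(n : ℝ))⁻¹ : ℝ) : ℂ) * Complex.exp ((Real.log (n : ℝ) : ℂ) * w) := by
    have e1 : ((n : ℝ)⁻¹ * (√(n : ℝ))⁻¹) = (n : ℝ) ^ (-(3 / 2) : ℝ) := by
      rw [Real.sqrt_eq_rpow, ← Real.rpow_neg_one (n : ℝ), ← Real.rpow_neg hn'.le,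
        ← Real.rpow_add hn']
      norm_num
    rw [e1, Complex.ofReal_cpow hn'.le, Complex.ofReal_log hn'.le, neg_sub, sub_eq_add_neg,
      add_comm, Complex.cpow_add _ _ hn, Complex.cpow_def_of_ne_zero hn w]
    push_cast
    rfl
  rw [hE]
  refine h2.congr_fun fun k => ?_
  rw [poissonWeight, logWeight, mul_pow]
  push_cast
  field_simp

lemma hasSum_poissonWeight_mul_pow_real (n : ℕ+) (r : ℝ) :
    HasSum (fun k => poissonWeight k n / √(n : ℝ) * r ^ k) ((n : ℝ) ^ (-(3 / 2 - r))) := by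
  have h := hasSum_poissonWeight_mul_pow n r
  rw [← Complex.hasSum_ofReal]
  have hn' : (0 : ℝ) ≤ n := by positivity
  rw [Complex.ofReal_cpow hn']
  push_cast at h ⊢
  exact h

/-- Taylor expansion of a Dirichlet series at `3 / 2`. -/
lemma hasSum_logCoef_mul_pow (x : H2) {w : ℂ} (hw : ‖w‖ < 1) :
    HasSum (fun k => logCoef k x * w ^ k) (H2series x (3 / 2 - w)) := by
  let f : ℕ+ × ℕ → ℂ := fun p => x p.1 * ((poissonWeight p.2 p.1 / √(p.1 : ℝ) : ℝ) : ℂ) * w ^ p.2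
  have hrow : ∀ n : ℕ+, HasSum (fun k => f (n, k)) (x n * (n : ℂ) ^ (-(3 / 2 - w))) := fun n =>
    ((hasSum_poissonWeight_mul_pow n w).mul_left (x n)).congr_fun fun k => by simp only [f]; ring
  have hrown : ∀ n : ℕ+, HasSum (fun k => ‖f (n, k)‖)
      (‖x n‖ * (n : ℝ) ^ (-(3 / 2 - ‖w‖))) := fun n =>
    ((hasSum_poissonWeight_mul_pow_real n ‖w‖).mul_left ‖x n‖).congr_fun fun k => by
      have h0 : 0 ≤ poissonWeight k n / √(n : ℝ) :=
        div_nonneg (poissonWeight_nonneg k n) (by positivity)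
      simp only [f]
      rw [norm_mul, norm_mul, Complex.norm_real, Real.norm_of_nonneg h0, norm_pow]; ring
  have hf : Summable f := by
    refine Summable.of_norm ?_
    rw [summable_prod_of_nonneg fun p => norm_nonneg _]
    refine ⟨fun n => (hrown n).summable, ?_⟩
    simp_rw [fun n => (hrown n).tsum_eq]
    refine summable_mul_of_summable_sq (fun n => norm_nonneg _) (fun n => by positivity)
      (H2_hasSum_norm_sq x).summable ?_
    have h1 : Summable fun n : ℕ => (n : ℝ) ^ (-(3 / 2 - ‖w‖) * 2) :=
      Real.summable_nat_rpow.2 (by linarith)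
    refine (h1.comp_injective PNat.coe_injective).congr fun n => ?_
    simp only [Function.comp]
    rw [Real.rpow_mul (by positivity)]
    norm_num
  have hcol : ∀ k : ℕ, HasSum (fun n => f (n, k)) (logCoef k x * w ^ k) := fun k =>
    (summable_norm_logCoef_term k x).of_norm.hasSum.mul_right (w ^ k)
  have hS : H2series x (3 / 2 - w) = ∑' p, f p := by
    rw [hf.tsum_prod' fun n => (hrow n).summable]
    exact tsum_congr fun n => (hrow n).tsum_eq.symm
  rw [hS]
  have h2 := (Equiv.prodComm ℕ ℕ+).hasSum_iff.2 hf.hasSum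
  exact h2.prod_fiberwise hcol

lemma card_le_of_abs_sub_lt {S : Finset ℕ} {μ r : ℝ} (hS : ∀ k ∈ S, |(k : ℝ) - μ| < r)
    (hr : 0 ≤ r) : (S.card : ℝ) ≤ 2 * r + 1 := by
  have hsub : S.map Nat.castEmbedding ⊆ Finset.Icc ⌈μ - r⌉ ⌊μ + r⌋ := by
    intro z hz
    obtain ⟨k, hk, rfl⟩ := Finset.mem_map.1 hz
    have h := abs_lt.1 (hS k hk)
    rw [Finset.mem_Icc, Int.ceil_le, Int.le_floor]
    simp only [Nat.castEmbedding_apply, Int.cast_natCast]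
    constructor <;> linarith [h.1, h.2]
  have h1 := Finset.card_le_card hsub
  rw [Finset.card_map, Int.card_Icc] at h1
  have h2 : ((⌊μ + r⌋ + 1 - ⌈μ - r⌉).toNat : ℝ) ≤ 2 * r + 1 := by
    rcases le_total 0 (⌊μ + r⌋ + 1 - ⌈μ - r⌉) with h | h
    · have h3 : ((⌊μ + r⌋ + 1 - ⌈μ - r⌉).toNat : ℝ) = ((⌊μ + r⌋ + 1 - ⌈μ - r⌉ : ℤ) : ℝ) := by
        rw [← Int.cast_natCast, Int.toNat_of_nonneg h]
      rw [h3]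
      push_cast
      linarith [Int.floor_le (μ + r), Int.le_ceil (μ - r)]
    · rw [Int.toNat_of_nonpos h]
      push_cast
      linarith
  exact le_trans (by exact_mod_cast h1) h2

/-- The dyadic range `[2 ^ p, 2 ^ (p + s))`. -/
def dyadicRange (p s : ℕ) : Finset ℕ+ := Finset.Ico ((2 : ℕ+) ^ p) ((2 : ℕ+) ^ (p + s))

lemma mem_dyadicRange {p s : ℕ} {n : ℕ+} :
    n ∈ dyadicRange p s ↔ (2 : ℕ) ^ p ≤ n ∧ (n : ℕ) < 2 ^ (p + s) := by
  rw [dyadicRange, Finset.mem_Ico, ← PNat.coe_le_coe, ← PNat.coe_lt_coe, PNat.pow_coe, PNat.pow_coe]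
  rfl

lemma log_mem_of_mem_dyadicRange {p s : ℕ} {n : ℕ+} (hn : n ∈ dyadicRange p s) :
    p * Real.log 2 ≤ Real.log n ∧ Real.log n ≤ (p + s) * Real.log 2 := by
  obtain ⟨h1, h2⟩ := mem_dyadicRange.1 hn
  have h1' : (2 : ℝ) ^ p ≤ n := by exact_mod_cast h1
  have h2' : (n : ℝ) ≤ 2 ^ (p + s) := by exact_mod_cast h2.le
  have hn' : (0 : ℝ) < n := by exact_mod_cast n.pos
  constructor
  · rw [← Real.log_pow]; exact Real.log_le_log (by positivity) h1'
  · have h := Real.log_le_log hn' h2'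
    rw [Real.log_pow] at h
    exact_mod_cast h

lemma sum_inv_dyadicRange (p s : ℕ) :
    (s : ℝ) / 2 ≤ ∑ n ∈ dyadicRange p s, (1 : ℝ) / n ∧
      ∑ n ∈ dyadicRange p s, (1 : ℝ) / n ≤ s := by
  induction s with
  | zero => simp [dyadicRange]
  | succ s ih =>
    have hu : dyadicRange p (s + 1) = dyadicRange p s ∪ dyadicRange (p + s) 1 := by
      ext n
      simp only [Finset.mem_union, mem_dyadicRange]
      have e1 : 2 ^ p ≤ 2 ^ (p + s) := Nat.pow_le_pow_right (by norm_num) (by omega)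
      have e2 : 2 ^ (p + s) ≤ 2 ^ (p + s + 1) := Nat.pow_le_pow_right (by norm_num) (by omega)
      rw [← add_assoc]
      omega
    have hd : Disjoint (dyadicRange p s) (dyadicRange (p + s) 1) := by
      rw [Finset.disjoint_left]
      intro n h1 h2
      rw [mem_dyadicRange] at h1 h2
      omega
    have hcard : (dyadicRange (p + s) 1).card = 2 ^ (p + s) := by
      rw [dyadicRange, PNat.card_Ico, PNat.pow_coe, PNat.pow_coe, PNat.val_ofNat, pow_succ]
      omega
    have hP : (0 : ℝ) < 2 ^ (p + s) := by positivity
    have hlo : (1 : ℝ) / 2 ≤ ∑ n ∈ dyadicRange (p + s) 1, (1 : ℝ) / n := by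
      have h := Finset.card_nsmul_le_sum (dyadicRange (p + s) 1) (fun n : ℕ+ => (1 : ℝ) / n)
        (1 / (2 * 2 ^ (p + s))) fun n hn => by
          have h2 : (n : ℝ) < 2 ^ (p + s + 1) := by exact_mod_cast (mem_dyadicRange.1 hn).2
          have hn' : (0 : ℝ) < n := by exact_mod_cast n.pos
          refine one_div_le_one_div_of_le hn' ?_
          rw [pow_succ] at h2
          linarith
      rw [hcard, nsmul_eq_mul] at h
      refine le_trans (le_of_eq ?_) h
      push_cast
      field_simp
    have hhi : ∑ n ∈ dyadicRange (p + s) 1, (1 : ℝ) / n ≤ 1 := by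
      have h := Finset.sum_le_card_nsmul (dyadicRange (p + s) 1) (fun n : ℕ+ => (1 : ℝ) / n)
        (1 / 2 ^ (p + s)) fun n hn => by
          have h2 : (2 : ℝ) ^ (p + s) ≤ n := by exact_mod_cast (mem_dyadicRange.1 hn).1
          exact one_div_le_one_div_of_le hP h2
      rw [hcard, nsmul_eq_mul] at h
      refine h.trans (le_of_eq ?_)
      push_cast
      field_simp
    rw [hu, Finset.sum_union hd]
    push_cast
    constructor <;> linarith [ih.1, ih.2]

/-- The vector with coefficients `n ^ (-1/2)` on a finite set of indices. -/
def sqrtInvVec (E : Finset ℕ+) : H2 :=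
  ⟨fun n => if n ∈ E then (((√(n : ℝ))⁻¹ : ℝ) : ℂ) else 0, by
    refine memℓp_gen ?_
    refine summable_of_ne_finset_zero (s := E) fun n hn => ?_
    simp [hn]⟩

lemma sqrtInvVec_apply (E : Finset ℕ+) (n : ℕ+) :
    sqrtInvVec E n = if n ∈ E then (((√(n : ℝ))⁻¹ : ℝ) : ℂ) else 0 := rfl

lemma logCoef_sqrtInvVec (k : ℕ) (E : Finset ℕ+) :
    logCoef k (sqrtInvVec E) = ((∑ n ∈ E, 1 / (n : ℝ) * poissonWeight k n : ℝ) : ℂ) := by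
  unfold logCoef
  rw [tsum_eq_sum (s := E) fun n hn => by rw [sqrtInvVec_apply, if_neg hn, zero_mul]]
  push_cast
  refine Finset.sum_congr rfl fun n hn => ?_
  rw [sqrtInvVec_apply, if_pos hn]
  have h : ((√(n : ℝ) : ℝ) : ℂ) * ((√(n : ℝ) : ℝ) : ℂ) = n := by
    rw [← Complex.ofReal_mul, Real.mul_self_sqrt (by positivity)]
    simp
  push_cast
  rw [← h]
  field_simp

lemma logCoef_sum {ι : Type*} (S : Finset ι) (k : ℕ) (a : ι → ℂ) (f : ι → H2) :
    logCoef k (∑ i ∈ S, a i • f i) = ∑ i ∈ S, a i * logCoef k (f i) := by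
  let l : H2 →ₗ[ℂ] ℂ :=
    { toFun := logCoef k
      map_add' := logCoef_add k
      map_smul' := logCoef_smul k }
  have h := map_sum l (fun i => a i • f i) S
  simp only [map_smul, smul_eq_mul] at h
  exact h

lemma norm_sum_sqrtInvVec_sq_le {ι : Type*} [Fintype ι] (E : ι → Finset ℕ+)
    (hE : Pairwise fun i j => Disjoint (E i) (E j)) {s : ℝ}
    (hs : ∀ i, ∑ n ∈ E i, (1 : ℝ) / n ≤ s) (a : ι → ℂ) :
    ‖∑ i, a i • sqrtInvVec (E i)‖ ^ 2 ≤ s * ∑ i, ‖a i‖ ^ 2 := by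
  classical
  have hpt : ∀ n : ℕ+, ‖(∑ i, a i • sqrtInvVec (E i) : H2) n‖ ^ 2 =
      ∑ i, ‖a i‖ ^ 2 * if n ∈ E i then (1 : ℝ) / n else 0 := by
    intro n
    have hv : (∑ i, a i • sqrtInvVec (E i) : H2) n = ∑ i, a i * sqrtInvVec (E i) n := by
      rw [lp.coeFn_sum, Finset.sum_apply]
      rfl
    rw [hv]
    simp only [sqrtInvVec_apply]
    by_cases h : ∃ i, n ∈ E i
    · obtain ⟨i, hi⟩ := h
      have hne : ∀ j, j ≠ i → n ∉ E j := fun j hj hnj =>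
        Finset.disjoint_left.1 (hE hj) hnj hi
      rw [Finset.sum_eq_single i (fun j _ hj => by simp [hne j hj]) (by simp),
        Finset.sum_eq_single i (fun j _ hj => by simp [hne j hj]) (by simp)]
      rw [if_pos hi, if_pos hi, norm_mul, mul_pow, Complex.norm_real, norm_inv, inv_pow,
        Real.norm_of_nonneg (Real.sqrt_nonneg _), Real.sq_sqrt (by positivity), one_div]
    · push Not at h
      simp [h]
  have h1 := H2_hasSum_norm_sq (∑ i, a i • sqrtInvVec (E i) : H2)
  simp_rw [hpt] at h1
  have h2 : HasSum (fun n : ℕ+ => ∑ i, ‖a i‖ ^ 2 * if n ∈ E i then (1 : ℝ) / n else 0)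
      (∑ i, ‖a i‖ ^ 2 * ∑ n ∈ E i, (1 : ℝ) / n) := by
    refine hasSum_sum fun i _ => HasSum.mul_left _ ?_
    have h3 : ∑ n ∈ E i, (1 : ℝ) / n = ∑ n ∈ E i, if n ∈ E i then (1 : ℝ) / n else 0 :=
      Finset.sum_congr rfl fun n hn => by rw [if_pos hn]
    rw [h3]
    exact hasSum_sum_of_ne_finset_zero fun n hn => by rw [if_neg hn]
  rw [h1.unique h2, Finset.mul_sum]
  refine Finset.sum_le_sum fun i _ => ?_
  rw [mul_comm s]
  exact mul_le_mul_of_nonneg_left (hs i) (sq_nonneg _)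

lemma one_sub_le_sum_poissonWeight (n : ℕ+) {d : ℝ} (hd : 0 < d) (J : Finset ℕ)
    (hJ : ∀ k, k ∉ J → d ≤ |(k : ℝ) - Real.log n|) :
    1 - Real.log n / d ^ 2 ≤ ∑ k ∈ J, poissonWeight k n := by
  classical
  have h := (hasSum_poissonWeight n)
  have key : 1 ≤ ∑ k ∈ J, poissonWeight k n + Real.log n / d ^ 2 := by
    refine le_of_tendsto h (Eventually.of_forall fun S => ?_)
    have hsplit := Finset.sum_inter_add_sum_sdiff S J fun k => poissonWeight k n
    have h1 : ∑ k ∈ S ∩ J, poissonWeight k n ≤ ∑ k ∈ J, poissonWeight k n :=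
      Finset.sum_le_sum_of_subset_of_nonneg Finset.inter_subset_right
        fun k _ _ => poissonWeight_nonneg k n
    have h2 : ∑ k ∈ S \ J, poissonWeight k n ≤ Real.log n / d ^ 2 :=
      sum_poissonWeight_le_of_dist n hd _ fun k hk => hJ k (Finset.mem_sdiff.1 hk).2
    linarith
  linarith

lemma sum_norm_sq_ge_of_diag_dominant {N : ℕ} (B : Fin N → Fin N → ℝ) {m e : ℝ} (hm : 0 ≤ m)
    (he : 0 ≤ e) (hdiag : ∀ i, m ≤ B i i) (hoff : ∀ i j, i ≠ j → |B i j| ≤ e)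
    (a : Fin N → ℂ) :
    (m ^ 2 / 2 - N ^ 2 * e ^ 2) * ∑ i, ‖a i‖ ^ 2 ≤ ∑ i, ‖∑ j, (B i j : ℂ) * a j‖ ^ 2 := by
  set A := ∑ j, ‖a j‖ with hA
  have hA0 : 0 ≤ A := Finset.sum_nonneg fun j _ => norm_nonneg _
  have hA2 : A ^ 2 ≤ N * ∑ i, ‖a i‖ ^ 2 := by
    have h := sq_sum_le_card_mul_sum_sq (s := (Finset.univ : Finset (Fin N))) (f := fun j => ‖a j‖)
    simpa using h
  have hrow : ∀ i, m ^ 2 * ‖a i‖ ^ 2 ≤ 2 * ‖∑ j, (B i j : ℂ) * a j‖ ^ 2 + 2 * (e * A) ^ 2 := by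
    intro i
    have h1 : ∑ j, (B i j : ℂ) * a j = B i i * a i +
        ∑ j ∈ Finset.univ.erase i, (B i j : ℂ) * a j :=
      (Finset.add_sum_erase _ _ (Finset.mem_univ i)).symm
    have h2 : ‖∑ j ∈ Finset.univ.erase i, (B i j : ℂ) * a j‖ ≤ e * A := by
      rw [hA, Finset.mul_sum]
      refine (norm_sum_le _ _).trans ((Finset.sum_le_sum fun j hj => ?_).trans
        (Finset.sum_le_sum_of_subset_of_nonneg (Finset.erase_subset i Finset.univ)
          fun j _ _ => mul_nonneg he (norm_nonneg _)))
      rw [norm_mul, Complex.norm_real, Real.norm_eq_abs]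
      exact mul_le_mul_of_nonneg_right (hoff i j (Finset.ne_of_mem_erase hj).symm) (norm_nonneg _)
    have h3 : m * ‖a i‖ ≤ ‖∑ j, (B i j : ℂ) * a j‖ + e * A := by
      have h4 : (B i i : ℂ) * a i = ∑ j, (B i j : ℂ) * a j -
        ∑ j ∈ Finset.univ.erase i, (B i j : ℂ) * a j := by rw [h1]; ring
      have h5 : ‖(B i i : ℂ) * a i‖ ≤ ‖∑ j, (B i j : ℂ) * a j‖ + e * A := by
        rw [h4]
        exact (norm_sub_le _ _).trans (by linarith)
      rw [norm_mul, Complex.norm_real, Real.norm_eq_abs] at h5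
      exact (mul_le_mul_of_nonneg_right ((hdiag i).trans (le_abs_self _)) (norm_nonneg _)).trans h5
    calc m ^ 2 * ‖a i‖ ^ 2 = (m * ‖a i‖) ^ 2 := by ring
      _ ≤ (‖∑ j, (B i j : ℂ) * a j‖ + e * A) ^ 2 := pow_le_pow_left₀ (by positivity) h3 2
      _ ≤ _ := by nlinarith [sq_nonneg (‖∑ j, (B i j : ℂ) * a j‖ - e * A)]
  have hsum := Finset.sum_le_sum fun i (_ : i ∈ Finset.univ) => hrow i
  rw [← Finset.mul_sum, Finset.sum_add_distrib, ← Finset.mul_sum, Finset.sum_const,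
    Finset.card_univ, Fintype.card_fin, nsmul_eq_mul] at hsum
  have h6 : (N : ℝ) * (2 * (e * A) ^ 2) ≤ 2 * N ^ 2 * e ^ 2 * ∑ i, ‖a i‖ ^ 2 := by
    have h7 : (N : ℝ) * (2 * (e * A) ^ 2) = 2 * N * e ^ 2 * A ^ 2 := by ring
    rw [h7]
    refine (mul_le_mul_of_nonneg_left hA2 (by positivity)).trans (le_of_eq (by ring))
  linarith

/-- On a suitable `N`-dimensional subspace, the norm is controlled by polynomially many
of the Taylor coefficients `logCoef k`. -/
theorem exists_logCoef_lower_bound {N : ℕ} (hN : 1 ≤ N) :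
    ∃ (f : Fin N → H2) (S : Finset ℕ), (∀ k ∈ S, 4 ≤ k ∧ k ≤ 6000 * N ^ 3) ∧
      ∀ a : Fin N → ℂ, (a ≠ 0 → ∑ i, a i • f i ≠ 0) ∧
        ‖∑ i, a i • f i‖ ^ 2 ≤ 120 * ∑ k ∈ S, ‖logCoef k (∑ i, a i • f i)‖ ^ 2 := by
  classical
  set s : ℕ := 1000 * N ^ 2 with hs
  have hN1 : (1 : ℝ) ≤ N := by exact_mod_cast hN
  have hsR : (s : ℝ) = 1000 * N ^ 2 := by rw [hs]; push_cast; ring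
  have hs1 : (1000 : ℝ) ≤ s := by rw [hsR]; nlinarith
  have hs0 : (0 : ℝ) < s := by linarith
  set L := Real.log 2 with hL
  have hL1 : 0.69 < L := by have := Real.log_two_gt_d9; rw [hL]; norm_num at *; linarith
  have hL2 : L < 0.7 := by have := Real.log_two_lt_d9; rw [hL]; norm_num at *; linarith
  have hL0 : 0 < L := by linarith
  have hsL : 0 < s * L := by positivity
  let p : Fin N → ℕ := fun j => 4 * s * (j + 1)
  let E : Fin N → Finset ℕ+ := fun j => dyadicRange (p j) s
  let μ : Fin N → ℝ := fun j => (4 * (j + 1) + 1 / 2) * (s * L)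
  let J : Fin N → Finset ℕ := fun j =>
    (Finset.range (6 * s * N)).filter fun k => |(k : ℝ) - μ j| < 3 / 2 * (s * L)
  have hjN : ∀ j : Fin N, ((j : ℕ) : ℝ) + 1 ≤ N := fun j => by exact_mod_cast j.2
  have hlog : ∀ j, ∀ n ∈ E j, |Real.log n - μ j| ≤ 1 / 2 * (s * L) := by
    intro j n hn
    have h := log_mem_of_mem_dyadicRange hn
    simp only [p] at h
    push_cast at h
    rw [abs_le]
    simp only [μ]
    constructor <;> nlinarith [h.1, h.2]
  have hlog5 : ∀ j, ∀ n ∈ E j, Real.log n / (s * L) ^ 2 ≤ 8 * N / s := by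
    intro j n hn
    have h := abs_le.1 (hlog j n hn)
    have h1 : Real.log n ≤ 5 * N * (s * L) := by
      have h2 : μ j ≤ (4 * N + 1 / 2) * (s * L) := by
        simp only [μ]
        exact mul_le_mul_of_nonneg_right (by linarith [hjN j]) hsL.le
      nlinarith [h.2]
    rw [div_le_div_iff₀ (by positivity) hs0]
    calc Real.log n * s ≤ 5 * N * (s * L) * s := mul_le_mul_of_nonneg_right h1 hs0.le
      _ = (5 * L) * (N * s * s) := by ring
      _ ≤ (8 * L ^ 2) * (N * s * s) := by
        refine mul_le_mul_of_nonneg_right ?_ (by positivity)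
        nlinarith
      _ = 8 * N * (s * L) ^ 2 := by ring
  have hsep : ∀ i j, i ≠ j → 4 * (s * L) ≤ |μ i - μ j| := by
    intro i j hij
    have h1 : μ i - μ j = 4 * (s * L) * (((i : ℕ) : ℝ) - ((j : ℕ) : ℝ)) := by
      simp only [μ]; ring
    have h2 : (1 : ℝ) ≤ |((i : ℕ) : ℝ) - ((j : ℕ) : ℝ)| := by
      have h3 : ((i : ℕ) : ℤ) - ((j : ℕ) : ℤ) ≠ 0 := fun h => hij (Fin.ext (by omega))
      have h4 := Int.one_le_abs h3
      exact_mod_cast h4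
    rw [h1, abs_mul, abs_of_pos (by positivity : 0 < 4 * (s * L))]
    nlinarith
  have hnotmem : ∀ j k, k ∉ J j → 3 / 2 * (s * L) ≤ |(k : ℝ) - μ j| := by
    intro j k hk
    by_contra! hlt
    refine hk (Finset.mem_filter.2 ⟨Finset.mem_range.2 ?_, hlt⟩)
    have h1 := (abs_lt.1 hlt).2
    have h2 : μ j ≤ (4 * N + 1 / 2) * (s * L) := by
      simp only [μ]
      exact mul_le_mul_of_nonneg_right (by linarith [hjN j]) hsL.le
    have h3 : (k : ℝ) < 6 * s * N := by
      have h4 : (k : ℝ) < (4 * N + 2) * (s * L) := by linarith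
      have h5 : (4 * N + 2) * (s * L) ≤ 6 * N * (s * 1) := by
        refine mul_le_mul (by linarith) ?_ hsL.le (by positivity)
        exact mul_le_mul_of_nonneg_left (by linarith) hs0.le
      linarith
    exact_mod_cast h3
  have hdisjE : Pairwise fun i j => Disjoint (E i) (E j) := by
    intro i j hij
    rw [Finset.disjoint_left]
    intro n hi hj
    have h1 := hlog i n hi
    have h2 := hlog j n hj
    have h3 := hsep i j hij
    have h4 := abs_sub_le (μ i) (Real.log n) (μ j)
    rw [abs_sub_comm (μ i) (Real.log n)] at h4
    linarith
  have hdisjJ : Pairwise fun i j => Disjoint (J i) (J j) := by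
    intro i j hij
    rw [Finset.disjoint_left]
    intro k hi hj
    have h1 := (Finset.mem_filter.1 hi).2
    have h2 := (Finset.mem_filter.1 hj).2
    have h3 := hsep i j hij
    have h4 := abs_sub_le (μ i) (k : ℝ) (μ j)
    rw [abs_sub_comm (μ i) (k : ℝ)] at h4
    linarith
  have hcardJ : ∀ i, ((J i).card : ℝ) ≤ 3 * s := by
    intro i
    have h := card_le_of_abs_sub_lt (S := J i) (μ := μ i) (r := 3 / 2 * (s * L))
      (fun k hk => (Finset.mem_filter.1 hk).2) (by positivity)
    nlinarith
  let B : Fin N → Fin N → ℝ := fun i j =>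
    ∑ k ∈ J i, ∑ n ∈ E j, 1 / (n : ℝ) * poissonWeight k n
  have hBeq : ∀ i j, B i j = ∑ n ∈ E j, 1 / (n : ℝ) * ∑ k ∈ J i, poissonWeight k n := by
    intro i j
    simp only [B]
    rw [Finset.sum_comm]
    exact Finset.sum_congr rfl fun n _ => (Finset.mul_sum _ _ _).symm
  have hW : ∀ j, (s : ℝ) / 2 ≤ ∑ n ∈ E j, (1 : ℝ) / n ∧ ∑ n ∈ E j, (1 : ℝ) / n ≤ s :=
    fun j => sum_inv_dyadicRange (p j) s
  have heps : 8 * (N : ℝ) / s ≤ 1 / 2 := by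
    rw [div_le_iff₀ hs0, hsR]; nlinarith
  have hdiag : ∀ i, (s : ℝ) / 4 ≤ B i i := by
    intro i
    rw [hBeq]
    have h1 : ∑ n ∈ E i, (1 : ℝ) / n * (1 / 2) ≤
        ∑ n ∈ E i, 1 / (n : ℝ) * ∑ k ∈ J i, poissonWeight k n := by
      refine Finset.sum_le_sum fun n hn => mul_le_mul_of_nonneg_left ?_ (by positivity)
      have h2 := one_sub_le_sum_poissonWeight n hsL (J i) fun k hk => by
        have h3 := hnotmem i k hk
        have h4 := hlog i n hn
        have h5 := abs_sub_le (k : ℝ) (Real.log n) (μ i)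
        linarith
      linarith [hlog5 i n hn]
    rw [← Finset.sum_mul] at h1
    linarith [(hW i).1]
  have hoff : ∀ i j, i ≠ j → |B i j| ≤ 8 * N := by
    intro i j hij
    rw [hBeq, abs_of_nonneg (Finset.sum_nonneg fun n _ => mul_nonneg (by positivity)
      (Finset.sum_nonneg fun k _ => poissonWeight_nonneg k n))]
    have h1 : ∑ n ∈ E j, 1 / (n : ℝ) * ∑ k ∈ J i, poissonWeight k n ≤
        ∑ n ∈ E j, (1 : ℝ) / n * (8 * N / s) := by
      refine Finset.sum_le_sum fun n hn => mul_le_mul_of_nonneg_left ?_ (by positivity)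
      refine (sum_poissonWeight_le_of_dist n hsL (J i) fun k hk => ?_).trans (hlog5 j n hn)
      have h2 := (Finset.mem_filter.1 hk).2
      have h3 := hsep i j hij
      have h4 := hlog j n hn
      have h5 := abs_sub_le (μ i) (k : ℝ) (μ j)
      have h6 := abs_sub_le (k : ℝ) (Real.log n) (μ j)
      rw [abs_sub_comm (μ i) (k : ℝ)] at h5
      linarith
    rw [← Finset.sum_mul] at h1
    refine h1.trans ((mul_le_mul_of_nonneg_right (hW j).2 (by positivity)).trans (le_of_eq ?_))
    field_simp
  refine ⟨fun i => sqrtInvVec (E i), Finset.univ.biUnion J, ?_, fun a => ?_⟩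
  · intro k hk
    obtain ⟨i, -, hi⟩ := Finset.mem_biUnion.1 hk
    obtain ⟨h1, h2⟩ := Finset.mem_filter.1 hi
    constructor
    · have h3 := (abs_lt.1 h2).1
      have h4 : 4 * (s * L) ≤ μ i := by
        simp only [μ]
        exact mul_le_mul_of_nonneg_right (by linarith [((i : ℕ).cast_nonneg (α := ℝ))]) hsL.le
      have h5 : (4 : ℝ) ≤ k := by nlinarith
      exact_mod_cast h5
    · have h3 := (Finset.mem_range.1 h1).le
      refine h3.trans (le_of_eq ?_)
      rw [hs]; ring
  set x : H2 := ∑ i, a i • sqrtInvVec (E i) with hx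
  have hy : ∀ i, ‖∑ j, (B i j : ℂ) * a j‖ ^ 2 ≤ 3 * s * ∑ k ∈ J i, ‖logCoef k x‖ ^ 2 := by
    intro i
    have h1 : ∑ j, (B i j : ℂ) * a j = ∑ k ∈ J i, logCoef k x := by
      simp_rw [hx, logCoef_sum, logCoef_sqrtInvVec]
      rw [Finset.sum_comm]
      refine Finset.sum_congr rfl fun j _ => ?_
      rw [← Finset.mul_sum, mul_comm]
      congr 1
      simp only [B]
      push_cast
      rfl
    rw [h1]
    have h2 : ‖∑ k ∈ J i, logCoef k x‖ ^ 2 ≤ (∑ k ∈ J i, ‖logCoef k x‖) ^ 2 :=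
      pow_le_pow_left₀ (norm_nonneg _) (norm_sum_le _ _) 2
    refine h2.trans (sq_sum_le_card_mul_sum_sq.trans ?_)
    exact mul_le_mul_of_nonneg_right (hcardJ i) (Finset.sum_nonneg fun k _ => sq_nonneg _)
  have hlow : (s : ℝ) * ∑ i, ‖a i‖ ^ 2 ≤
      120 * ∑ k ∈ Finset.univ.biUnion J, ‖logCoef k x‖ ^ 2 := by
    have h1 := sum_norm_sq_ge_of_diag_dominant B (by positivity : (0 : ℝ) ≤ s / 4)
      (by positivity : (0 : ℝ) ≤ 8 * N) hdiag hoff a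
    have h2 := h1.trans (Finset.sum_le_sum fun i _ => hy i)
    rw [← Finset.mul_sum, ← Finset.sum_biUnion fun i _ j _ hij => hdisjJ hij] at h2
    have h3 : (s : ℝ) ^ 2 / 40 ≤ ((s : ℝ) / 4) ^ 2 / 2 - N ^ 2 * (8 * N) ^ 2 := by
      rw [hsR]
      have : (0 : ℝ) ≤ N ^ 4 := by positivity
      nlinarith
    have h4 := (mul_le_mul_of_nonneg_right h3
      (Finset.sum_nonneg fun i _ => sq_nonneg ‖a i‖)).trans h2
    have h5 : (s : ℝ) * ((s : ℝ) * ∑ i, ‖a i‖ ^ 2) ≤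
        s * (120 * ∑ k ∈ Finset.univ.biUnion J, ‖logCoef k x‖ ^ 2) := by linarith
    exact le_of_mul_le_mul_left h5 hs0
  refine ⟨fun ha h0 => ha ?_, ?_⟩
  · rw [h0] at hlow
    have hz : ∀ k, logCoef k (0 : H2) = 0 := fun k => by
      have := norm_logCoef_le k (0 : H2)
      rw [norm_zero, mul_zero] at this
      exact norm_le_zero_iff.1 this
    simp only [hz, norm_zero, ne_eq, OfNat.ofNat_ne_zero, not_false_eq_true, zero_pow,
      Finset.sum_const_zero, mul_zero] at hlow
    have h1 : ∑ i, ‖a i‖ ^ 2 ≤ 0 := by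
      by_contra! hpos
      exact absurd hlow (not_le.2 (mul_pos hs0 hpos))
    have h2 := (Finset.sum_eq_zero_iff_of_nonneg fun i _ => sq_nonneg ‖a i‖).1
      (le_antisymm h1 (Finset.sum_nonneg fun i _ => sq_nonneg _))
    funext i
    simpa using h2 i (Finset.mem_univ i)
  · exact (norm_sum_sqrtInvVec_sq_le E hdisjE (fun i => (hW i).2) a).trans hlow

/-- The index `2 ^ j * 3 ^ k` attached to the pair `(k, j)`. -/
def smoothIdx (p : ℕ × ℕ) : ℕ+ := 2 ^ p.2 * 3 ^ p.1

lemma smoothIdx_coe (p : ℕ × ℕ) : (smoothIdx p : ℕ) = 2 ^ p.2 * 3 ^ p.1 := by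
  rw [smoothIdx, PNat.mul_coe, PNat.pow_coe, PNat.pow_coe]
  rfl

lemma smoothIdx_injective : Function.Injective smoothIdx := by
  intro p q h
  have h1 : (2 : ℕ) ^ p.2 * 3 ^ p.1 = 2 ^ q.2 * 3 ^ q.1 := by
    rw [← smoothIdx_coe, ← smoothIdx_coe, h]
  have h2 := congrArg (fun n => n.factorization 2) h1
  have h3 := congrArg (fun n => n.factorization 3) h1
  have e2 : Nat.factorization 2 3 = 0 := Nat.factorization_eq_zero_of_not_dvd (by norm_num)
  have e3 : Nat.factorization 3 2 = 0 := Nat.factorization_eq_zero_of_not_dvd (by norm_num)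
  have f2 : Nat.factorization 2 2 = 1 := Nat.Prime.factorization_self Nat.prime_two
  have f3 : Nat.factorization 3 3 = 1 := Nat.Prime.factorization_self Nat.prime_three
  simp [Nat.factorization_mul, Nat.factorization_pow, e2, e3, f2, f3] at h2 h3
  exact Prod.ext h3 h2

lemma natCast_pow_cpow (m j : ℕ) (s : ℂ) : (((m ^ j : ℕ) : ℂ)) ^ s = ((m : ℂ) ^ s) ^ j := by
  induction j with
  | zero => simp
  | succ j ih => rw [pow_succ, Nat.cast_mul, Complex.natCast_mul_natCast_cpow, ih, pow_succ]

lemma smoothIdx_cpow (p : ℕ × ℕ) (s : ℂ) :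
    ((smoothIdx p : ℕ) : ℂ) ^ s = ((2 : ℂ) ^ s) ^ p.2 * ((3 : ℂ) ^ s) ^ p.1 := by
  rw [smoothIdx_coe, Nat.cast_mul, Complex.natCast_mul_natCast_cpow, natCast_pow_cpow,
    natCast_pow_cpow]
  norm_num

lemma summable_norm_sq_extend {h : ℕ × ℕ → ℂ} (hh : Summable fun p => ‖h p‖ ^ 2) :
    Memℓp (Function.extend smoothIdx h (0 : ℕ+ → ℂ)) 2 := by
  refine memℓp_gen ?_
  have h1 : (fun n => ‖Function.extend smoothIdx h 0 n‖ ^ (2 : ENNReal).toReal) =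
      Function.extend smoothIdx (fun p => ‖h p‖ ^ 2) 0 := by
    funext n
    by_cases hn : ∃ p, smoothIdx p = n
    · obtain ⟨p, rfl⟩ := hn
      simp [smoothIdx_injective.extend_apply]
    · simp [Function.extend_apply' _ _ _ hn]
  rw [h1]
  exact (summable_extend_zero smoothIdx_injective).2 hh

/-- The element of `ℋ²` supported on the integers `2 ^ j * 3 ^ k`. -/
def smoothVec (h : ℕ × ℕ → ℂ) (hh : Summable fun p => ‖h p‖ ^ 2) : H2 :=
  ⟨Function.extend smoothIdx h 0, summable_norm_sq_extend hh⟩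

lemma smoothVec_apply_idx {h : ℕ × ℕ → ℂ} (hh : Summable fun p => ‖h p‖ ^ 2) (p : ℕ × ℕ) :
    smoothVec h hh (smoothIdx p) = h p :=
  smoothIdx_injective.extend_apply h (0 : ℕ+ → ℂ) p

lemma smoothVec_apply_of_not {h : ℕ × ℕ → ℂ} (hh : Summable fun p => ‖h p‖ ^ 2) {n : ℕ+}
    (hn : ¬∃ p, smoothIdx p = n) : smoothVec h hh n = 0 :=
  Function.extend_apply' h (0 : ℕ+ → ℂ) n hn

lemma hasSum_smoothVec {h : ℕ × ℕ → ℂ} (hh : Summable fun p => ‖h p‖ ^ 2) :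
    HasSum (fun p => ‖h p‖ ^ 2) (‖smoothVec h hh‖ ^ 2) := by
  have h1 := H2_hasSum_norm_sq (smoothVec h hh)
  rw [← smoothIdx_injective.hasSum_iff fun n hn => ?_] at h1
  · refine h1.congr_fun fun p => ?_
    rw [Function.comp_apply, smoothVec_apply_idx]
  · rw [smoothVec_apply_of_not hh hn]; simp

lemma summable_H2series (x : H2) {s : ℂ} (hs : 1 / 2 < s.re) :
    Summable fun n : ℕ+ => x n * (n : ℂ) ^ (-s) := by
  refine Summable.of_norm ?_
  have h1 : ∀ n : ℕ+, ‖x n * (n : ℂ) ^ (-s)‖ = ‖x n‖ * (n : ℝ) ^ (-s.re) := fun n => by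
    rw [norm_mul, Complex.norm_natCast_cpow_of_pos n.pos, Complex.neg_re]
  simp_rw [h1]
  refine summable_mul_of_summable_sq (fun n => norm_nonneg _) (fun n => by positivity)
    (H2_hasSum_norm_sq x).summable ?_
  have h2 : Summable fun n : ℕ => (n : ℝ) ^ (-s.re * 2) :=
    Real.summable_nat_rpow.2 (by linarith)
  refine (h2.comp_injective PNat.coe_injective).congr fun n => ?_
  simp only [Function.comp]
  rw [Real.rpow_mul (by positivity)]
  norm_num

lemma hasSum_H2series_smoothVec {h : ℕ × ℕ → ℂ} (hh : Summable fun p => ‖h p‖ ^ 2) {s : ℂ}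
    (hs : 1 / 2 < s.re) :
    HasSum (fun p : ℕ × ℕ => h p * (((2 : ℂ) ^ (-s)) ^ p.2 * ((3 : ℂ) ^ (-s)) ^ p.1))
      (H2series (smoothVec h hh) s) := by
  have h1 := (summable_H2series (smoothVec h hh) hs).hasSum
  rw [← smoothIdx_injective.hasSum_iff fun n hn => ?_] at h1
  · refine h1.congr_fun fun p => ?_
    rw [Function.comp_apply, smoothVec_apply_idx, smoothIdx_cpow]
  · rw [smoothVec_apply_of_not hh hn, zero_mul]

/-- Rows of `c` lie in the unit ball of `ℓ²`. -/
def RowBounded (c : ℕ → ℕ → ℂ) : Prop :=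
  ∀ k, Summable (fun j => ‖c k j‖ ^ 2) ∧ ∑' j, ‖c k j‖ ^ 2 ≤ 1

lemma RowBounded.hasSum_row {c : ℕ → ℕ → ℂ} (hc : RowBounded c) (x : H2) (k : ℕ) :
    HasSum (fun j => ‖logCoef k x * c k j‖ ^ 2) (‖logCoef k x‖ ^ 2 * ∑' j, ‖c k j‖ ^ 2) := by
  refine ((hc k).1.hasSum.mul_left (‖logCoef k x‖ ^ 2)).congr_fun fun j => ?_
  rw [norm_mul, mul_pow]

lemma RowBounded.summable {c : ℕ → ℕ → ℂ} (hc : RowBounded c) (x : H2) :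
    Summable fun p : ℕ × ℕ => ‖logCoef p.1 x * c p.1 p.2‖ ^ 2 := by
  rw [summable_prod_of_nonneg fun p => sq_nonneg _]
  refine ⟨fun k => (hc.hasSum_row x k).summable, ?_⟩
  simp_rw [fun k => (hc.hasSum_row x k).tsum_eq]
  exact Summable.of_nonneg_of_le
    (fun k => mul_nonneg (sq_nonneg _) (tsum_nonneg fun j => sq_nonneg _))
    (fun k => mul_le_of_le_one_right (sq_nonneg _) (hc k).2) (summable_norm_logCoef_sq x)

lemma RowBounded.hasSum_norm_sq {c : ℕ → ℕ → ℂ} (hc : RowBounded c) (x : H2) :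
    HasSum (fun k => ‖logCoef k x‖ ^ 2 * ∑' j, ‖c k j‖ ^ 2)
      (‖smoothVec (fun p => logCoef p.1 x * c p.1 p.2) (hc.summable x)‖ ^ 2) :=
  (hasSum_smoothVec (hc.summable x)).prod_fiberwise fun k => hc.hasSum_row x k

lemma RowBounded.norm_smoothVec_le {c : ℕ → ℕ → ℂ} (hc : RowBounded c) {b : ℝ} (hb : 0 ≤ b)
    (hcb : ∀ k, ∑' j, ‖c k j‖ ^ 2 ≤ b ^ 2) (x : H2) :
    ‖smoothVec (fun p => logCoef p.1 x * c p.1 p.2) (hc.summable x)‖ ≤ 2 * b * ‖x‖ := by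
  have h1 : ‖smoothVec (fun p => logCoef p.1 x * c p.1 p.2) (hc.summable x)‖ ^ 2 ≤
      (2 * b * ‖x‖) ^ 2 := by
    rw [← (hc.hasSum_norm_sq x).tsum_eq]
    calc _ ≤ ∑' k, ‖logCoef k x‖ ^ 2 * b ^ 2 :=
          Summable.tsum_le_tsum (fun k => mul_le_mul_of_nonneg_left (hcb k) (sq_nonneg _))
            (hc.hasSum_norm_sq x).summable ((summable_norm_logCoef_sq x).mul_right _)
      _ = (∑' k, ‖logCoef k x‖ ^ 2) * b ^ 2 := tsum_mul_right
      _ ≤ (4 * ‖x‖ ^ 2) * b ^ 2 := by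
          refine mul_le_mul_of_nonneg_right ?_ (sq_nonneg _)
          exact Real.tsum_le_of_sum_le (fun _ => sq_nonneg _) fun S => sum_norm_logCoef_sq_le S x
      _ = _ := by ring
  exact (sq_le_sq₀ (norm_nonneg _) (by positivity)).1 h1

/-- The operator sending `x` to the vector with coefficient `logCoef k x * c k j` at
`2 ^ j * 3 ^ k`. -/
def rowOp (c : ℕ → ℕ → ℂ) (hc : RowBounded c) : H2 →L[ℂ] H2 :=
  LinearMap.mkContinuous
    { toFun := fun x => smoothVec (fun p => logCoef p.1 x * c p.1 p.2) (hc.summable x)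
      map_add' := fun x y => by
        ext n
        rw [lp.coeFn_add, Pi.add_apply]
        by_cases hn : ∃ p, smoothIdx p = n
        · obtain ⟨p, rfl⟩ := hn
          simp only [smoothVec_apply_idx]
          rw [logCoef_add, add_mul]
        · simp only [smoothVec_apply_of_not _ hn, add_zero]
      map_smul' := fun a x => by
        ext n
        rw [lp.coeFn_smul, Pi.smul_apply, RingHom.id_apply]
        by_cases hn : ∃ p, smoothIdx p = n
        · obtain ⟨p, rfl⟩ := hn
          simp only [smoothVec_apply_idx]
          rw [logCoef_smul, smul_eq_mul, mul_assoc]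
        · simp only [smoothVec_apply_of_not _ hn, smul_zero] }
    (2 * 1) fun x => hc.norm_smoothVec_le zero_le_one (fun k => by simpa using (hc k).2) x

lemma rowOp_apply {c : ℕ → ℕ → ℂ} (hc : RowBounded c) (x : H2) :
    rowOp c hc x = smoothVec (fun p => logCoef p.1 x * c p.1 p.2) (hc.summable x) := rfl

lemma norm_rowOp_le {c : ℕ → ℕ → ℂ} (hc : RowBounded c) {b : ℝ} (hb : 0 ≤ b)
    (hcb : ∀ k, ∑' j, ‖c k j‖ ^ 2 ≤ b ^ 2) : ‖rowOp c hc‖ ≤ 2 * b :=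
  ContinuousLinearMap.opNorm_le_bound _ (by positivity) fun x => hc.norm_smoothVec_le hb hcb x

lemma RowBounded.ite {c : ℕ → ℕ → ℂ} (hc : RowBounded c) (P : ℕ → Prop) [DecidablePred P] :
    RowBounded fun k j => if P k then c k j else 0 := by
  intro k
  by_cases hk : P k
  · simpa [hk] using hc k
  · simp [hk]

lemma rowOp_sub_ite {c : ℕ → ℕ → ℂ} (hc : RowBounded c) (P : ℕ → Prop) [DecidablePred P] :
    rowOp c hc - rowOp _ (hc.ite P) = rowOp _ (hc.ite fun k => ¬P k) := by
  ext x n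
  rw [sub_apply, lp.coeFn_sub, Pi.sub_apply]
  simp only [rowOp_apply]
  by_cases hn : ∃ p, smoothIdx p = n
  · obtain ⟨p, rfl⟩ := hn
    simp only [smoothVec_apply_idx]
    by_cases hp : P p.1 <;> simp [hp]
  · simp only [smoothVec_apply_of_not _ hn, sub_zero]

lemma finrank_range_rowOp_ite_lt {c : ℕ → ℕ → ℂ} (hc : RowBounded c) (m : ℕ) :
    FiniteDimensional ℂ (LinearMap.range (rowOp _ (hc.ite fun k => k < m) : H2 →ₗ[ℂ] H2)) ∧
      Module.finrank ℂ (LinearMap.range (rowOp _ (hc.ite fun k => k < m) : H2 →ₗ[ℂ] H2)) ≤ m := by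
  classical
  have hu : ∀ k, Summable fun p : ℕ × ℕ => ‖if p.1 = k then c k p.2 else 0‖ ^ 2 := by
    intro k
    have hinj : Function.Injective fun j : ℕ => (k, j) := fun a b h => (Prod.ext_iff.1 h).2
    rw [← hinj.summable_iff fun p hp => ?_]
    · exact (hc k).1.congr fun j => by simp
    · rw [if_neg fun h => hp ⟨p.2, Prod.ext h.symm rfl⟩]
      simp
  let u : ℕ → H2 := fun k => smoothVec _ (hu k)
  have hle : LinearMap.range (rowOp _ (hc.ite fun k => k < m) : H2 →ₗ[ℂ] H2) ≤
      Submodule.span ℂ (((Finset.range m).image u : Finset H2) : Set H2) := by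
    rintro _ ⟨x, rfl⟩
    have hx : rowOp _ (hc.ite fun k => k < m) x = ∑ k ∈ Finset.range m, logCoef k x • u k := by
      ext n
      have hv : (∑ k ∈ Finset.range m, logCoef k x • u k : H2) n =
          ∑ k ∈ Finset.range m, logCoef k x * u k n := by
        rw [lp.coeFn_sum, Finset.sum_apply]
        rfl
      rw [hv]
      simp only [rowOp_apply, u]
      by_cases hn : ∃ p, smoothIdx p = n
      · obtain ⟨p, rfl⟩ := hn
        simp only [smoothVec_apply_idx]
        by_cases hp : p.1 < m
        · rw [Finset.sum_eq_single p.1 (fun k _ hk => by rw [if_neg hk.symm, mul_zero])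
            fun h => absurd (Finset.mem_range.2 hp) h]
          simp [hp]
        · rw [if_neg hp, mul_zero, Finset.sum_eq_zero fun k hk => ?_]
          rw [if_neg (by rintro rfl; exact hp (Finset.mem_range.1 hk)), mul_zero]
      · simp only [smoothVec_apply_of_not _ hn, mul_zero, Finset.sum_const_zero]
    rw [ContinuousLinearMap.coe_coe, hx]
    exact Submodule.sum_mem _ fun k hk => Submodule.smul_mem _ _
      (Submodule.subset_span (Finset.mem_coe.2 (Finset.mem_image_of_mem u hk)))
  refine ⟨Submodule.finiteDimensional_of_le hle, (Submodule.finrank_mono hle).trans ?_⟩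
  exact (finrank_span_finset_le_card _).trans
    (Finset.card_image_le.trans (Finset.card_range m).le)

lemma norm_two_cpow_lt_one {s : ℂ} (hs : 0 < s.re) : ‖(2 : ℂ) ^ (-s)‖ < 1 := by
  have h := Complex.norm_natCast_cpow_of_pos (n := 2) (by norm_num) (-s)
  rw [Nat.cast_ofNat] at h
  rw [h, Complex.neg_re]
  exact Real.rpow_lt_one_of_one_lt_of_neg (by norm_num) (by linarith)

lemma norm_three_cpow_lt_one {s : ℂ} (hs : 0 < s.re) : ‖(3 : ℂ) ^ (-s)‖ < 1 := by
  have h := Complex.norm_natCast_cpow_of_pos (n := 3) (by norm_num) (-s)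
  rw [Nat.cast_ofNat] at h
  rw [h, Complex.neg_re]
  exact Real.rpow_lt_one_of_one_lt_of_neg (by norm_num) (by linarith)

lemma norm_three_cpow_mul_lt_one {F : ℂ → ℂ} (hF : ∀ z, ‖z‖ < 1 → ‖F z‖ ≤ 1) {s : ℂ}
    (hs : 0 < s.re) : ‖(3 : ℂ) ^ (-s) * F (2 ^ (-s))‖ < 1 := by
  rw [norm_mul]
  exact mul_lt_one_of_nonneg_of_lt_one_left (norm_nonneg _) (norm_three_cpow_lt_one hs)
    (hF _ (norm_two_cpow_lt_one hs))

lemma isCompOp_rowOp {c : ℕ → ℕ → ℂ} (hc : RowBounded c) {F : ℂ → ℂ}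
    (hF : ∀ z, ‖z‖ < 1 → ‖F z‖ ≤ 1)
    (hFc : ∀ k z, ‖z‖ < 1 → HasSum (fun j => c k j * z ^ j) (F z ^ k)) :
    IsCompOp (fun s => 3 / 2 - (3 : ℂ) ^ (-s) * F (2 ^ (-s))) (rowOp c hc) := by
  intro x s hs
  have hs0 : 0 < s.re := by linarith
  have h1 := hasSum_logCoef_mul_pow x (norm_three_cpow_mul_lt_one hF hs0)
  refine HasSum.unique ?_ h1
  refine (hasSum_H2series_smoothVec (hc.summable x) hs).prod_fiberwise fun k => ?_
  have h2 := (hFc k _ (norm_two_cpow_lt_one hs0)).mul_left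
    (logCoef k x * ((3 : ℂ) ^ (-s)) ^ k)
  rw [show logCoef k x * ((3 : ℂ) ^ (-s) * F (2 ^ (-s))) ^ k =
    logCoef k x * ((3 : ℂ) ^ (-s)) ^ k * F (2 ^ (-s)) ^ k by rw [mul_pow]; ring]
  exact h2.congr_fun fun j => by ring

lemma RowBounded.norm_le_one {c : ℕ → ℕ → ℂ} (hc : RowBounded c) (k j : ℕ) : ‖c k j‖ ≤ 1 := by
  have h := ((hc k).1.le_tsum j fun i _ => sq_nonneg _).trans (hc k).2
  nlinarith [norm_nonneg (c k j)]

/-- The coefficients of the Dirichlet series `3 / 2 - 3 ^ (-s) * F (2 ^ (-s))`. -/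
def symbolCoef (c : ℕ → ℕ → ℂ) : ℕ → ℂ :=
  Function.extend (fun j : ℕ => (smoothIdx (1, j) : ℕ)) (fun j => -c 1 j)
    fun n => if n = 1 then 3 / 2 else 0

lemma smoothIdx_one_injective : Function.Injective fun j : ℕ => (smoothIdx (1, j) : ℕ) :=
  fun _ _ h => (Prod.ext_iff.1 (smoothIdx_injective (PNat.coe_injective h))).2

lemma term_symbolCoef (c : ℕ → ℕ → ℂ) (s : ℂ) (n : ℕ) :
    LSeries.term (symbolCoef c) s n =
      Function.extend (fun j : ℕ => (smoothIdx (1, j) : ℕ))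
        (fun j => -(3 : ℂ) ^ (-s) * (c 1 j * ((2 : ℂ) ^ (-s)) ^ j)) 0 n +
        if n = 1 then 3 / 2 else 0 := by
  by_cases hn : ∃ j, (fun j : ℕ => (smoothIdx (1, j) : ℕ)) j = n
  · obtain ⟨j, rfl⟩ := hn
    have h1 : (smoothIdx (1, j) : ℕ) ≠ 1 := by
      rw [smoothIdx_coe]
      have := Nat.one_le_two_pow (n := j)
      simp only [pow_one]
      omega
    rw [smoothIdx_one_injective.extend_apply, if_neg h1, LSeries.term_of_ne_zero (PNat.ne_zero _),
      symbolCoef, smoothIdx_one_injective.extend_apply, div_eq_mul_inv, ← Complex.cpow_neg,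
      smoothIdx_cpow]
    ring
  · rw [Function.extend_apply' _ _ _ hn, Pi.zero_apply, zero_add]
    rcases eq_or_ne n 0 with rfl | h0
    · simp
    rw [LSeries.term_of_ne_zero h0, symbolCoef, Function.extend_apply' _ _ _ hn]
    by_cases h1 : n = 1
    · simp [h1]
    · simp [h1]

lemma dsConvUnif_symbolCoef {c : ℕ → ℕ → ℂ} (hc : RowBounded c) {F : ℂ → ℂ}
    (hFc : ∀ k z, ‖z‖ < 1 → HasSum (fun j => c k j * z ^ j) (F z ^ k)) :
    DSConvUnif (symbolCoef c) fun s => 3 / 2 - (3 : ℂ) ^ (-s) * F (2 ^ (-s)) := by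
  intro ε hε
  have hq0 : (0 : ℝ) ≤ 2 ^ (-ε) := by positivity
  have hq1 : (2 : ℝ) ^ (-ε) < 1 :=
    Real.rpow_lt_one_of_one_lt_of_neg (by norm_num) (by linarith)
  have hu : Summable fun n : ℕ => Function.extend (fun j : ℕ => (smoothIdx (1, j) : ℕ))
      (fun j => ((2 : ℝ) ^ (-ε)) ^ j) 0 n + if n = 1 then (3 / 2 : ℝ) else 0 :=
    ((summable_extend_zero smoothIdx_one_injective).2
      (summable_geometric_of_lt_one hq0 hq1)).add (hasSum_ite_eq 1 (3 / 2 : ℝ)).summable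
  have h := tendstoUniformlyOn_tsum_nat (f := fun n s => LSeries.term (symbolCoef c) s n) hu
    (s := {s : ℂ | ε < s.re}) fun n s hs => by
      rw [term_symbolCoef]
      refine (norm_add_le _ _).trans (add_le_add ?_ ?_)
      · by_cases hn : ∃ j, (fun j : ℕ => (smoothIdx (1, j) : ℕ)) j = n
        · obtain ⟨j, rfl⟩ := hn
          rw [smoothIdx_one_injective.extend_apply, smoothIdx_one_injective.extend_apply]
          have hs' : ε < s.re := hs
          have h2 : ‖(2 : ℂ) ^ (-s)‖ ≤ (2 : ℝ) ^ (-ε) := by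
            have h := Complex.norm_natCast_cpow_of_pos (n := 2) (by norm_num) (-s)
            rw [Nat.cast_ofNat] at h
            rw [h, Complex.neg_re]
            exact Real.rpow_le_rpow_of_exponent_le (by norm_num) (by linarith)
          rw [norm_mul, norm_mul, norm_neg, norm_pow]
          calc _ ≤ 1 * (1 * ((2 : ℝ) ^ (-ε)) ^ j) :=
                mul_le_mul (norm_three_cpow_lt_one (by linarith)).le
                  (mul_le_mul (hc.norm_le_one 1 j) (pow_le_pow_left₀ (norm_nonneg _) h2 j)
                    (by positivity) zero_le_one) (by positivity) zero_le_one
            _ = _ := by ring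
        · rw [Function.extend_apply' _ _ _ hn, Function.extend_apply' _ _ _ hn]
          simp
      · split_ifs <;> simp
  refine h.congr_right fun s hs => ?_
  have hs0 : 0 < s.re := hε.trans hs
  have h1 := hFc 1 _ (norm_two_cpow_lt_one hs0)
  have h2 := ((hasSum_extend_zero smoothIdx_one_injective).2
    (h1.mul_left (-(3 : ℂ) ^ (-s)))).add (hasSum_ite_eq 1 (3 / 2 : ℂ))
  simp_rw [term_symbolCoef]
  rw [h2.tsum_eq, pow_one]
  ring

lemma isCompactOperator_of_finiteDimensional_range {E F : Type*} [NormedAddCommGroup E]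
    [NormedSpace ℂ E] [NormedAddCommGroup F] [NormedSpace ℂ F] (R : E →L[ℂ] F)
    [FiniteDimensional ℂ (LinearMap.range (R : E →ₗ[ℂ] F))] : IsCompactOperator R := by
  let V := LinearMap.range (R : E →ₗ[ℂ] F)
  let R' : E →L[ℂ] V := R.codRestrict V fun x => ⟨x, rfl⟩
  have : ProperSpace V := FiniteDimensional.proper ℂ V
  exact (isCompactOperator_of_locallyCompactSpace_rng V.subtypeL).comp_clm R'

lemma approxNumber_le {E F : Type*} [NormedAddCommGroup E] [NormedSpace ℂ E]
    [NormedAddCommGroup F] [NormedSpace ℂ F] (T R : E →L[ℂ] F) {n : ℕ}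
    (hR : FiniteDimensional ℂ (LinearMap.range (R : E →ₗ[ℂ] F)))
    (hn : Module.finrank ℂ (LinearMap.range (R : E →ₗ[ℂ] F)) < n) :
    approxNumber T n ≤ ‖T - R‖ := by
  refine csInf_le ⟨0, ?_⟩ ⟨R, hR, hn, rfl⟩
  rintro _ ⟨_, -, -, rfl⟩
  exact norm_nonneg _

/-- If `T` is bounded below by `b` on an `n`-dimensional subspace, then `a_n(T) ≥ b`. -/
lemma le_approxNumber {E F : Type*} [NormedAddCommGroup E] [NormedSpace ℂ E]
    [NormedAddCommGroup F] [NormedSpace ℂ F] (T : E →L[ℂ] F) {n : ℕ} (hn : 1 ≤ n) {b : ℝ}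
    (f : Fin n → E) (hf : ∀ a : Fin n → ℂ, a ≠ 0 → ∑ i, a i • f i ≠ 0)
    (hT : ∀ a : Fin n → ℂ, b * ‖∑ i, a i • f i‖ ≤ ‖T (∑ i, a i • f i)‖) :
    b ≤ approxNumber T n := by
  refine le_csInf ⟨‖T - 0‖, 0, ?_, ?_, rfl⟩ ?_
  · rw [ContinuousLinearMap.toLinearMap_zero, LinearMap.range_zero]; infer_instance
  · rw [ContinuousLinearMap.toLinearMap_zero, LinearMap.range_zero, finrank_bot]; omega
  rintro _ ⟨R, hR, hRn, rfl⟩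
  let G : (Fin n → ℂ) →ₗ[ℂ] LinearMap.range (R : E →ₗ[ℂ] F) :=
    (R : E →ₗ[ℂ] F).rangeRestrict ∘ₗ Fintype.linearCombination ℂ f
  have hker : LinearMap.ker G ≠ ⊥ := LinearMap.ker_ne_bot_of_finrank_lt (by simpa using hRn)
  obtain ⟨a, ha, ha0⟩ := (Submodule.ne_bot_iff _).1 hker
  have hRx : R (∑ i, a i • f i) = 0 := by
    have h := congrArg Subtype.val (LinearMap.mem_ker.1 ha)
    simpa [G, Fintype.linearCombination_apply] using h
  have hx := norm_pos_iff.2 (hf a ha0)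
  have h1 := (T - R).le_opNorm (∑ i, a i • f i)
  rw [sub_apply, hRx, sub_zero] at h1
  exact le_of_mul_le_mul_right ((hT a).trans h1) hx

theorem stmt8 (g : ℝ → ℝ) (hpos : ∀ x : ℝ, 1 ≤ x → 0 < g x)
    (hmono : AntitoneOn g (Set.Ici 1)) (hlim : Tendsto g atTop (nhds 0))
    (δ : ℝ) (hδ : 0 < δ) (hsq : ∀ x : ℝ, 1 ≤ x → δ * g x ≤ g (x ^ 2)) :
    ∃ (c : ℕ → ℂ) (φ : ℂ → ℂ), DSConvUnif c φ ∧
      (∀ s : ℂ, 0 < s.re → 1 / 2 < (φ s).re) ∧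
      ∃ T : H2 →L[ℂ] H2, IsCompOp φ T ∧ IsCompactOperator ⇑T ∧
        ∃ cl Cu : ℝ, 0 < cl ∧ cl ≤ Cu ∧ ∃ N : ℕ, 1 ≤ N ∧
          ∀ n : ℕ, N ≤ n →
            cl * g n ≤ approxNumber T n ∧ approxNumber T n ≤ Cu * g n := by
  obtain ⟨α, hα, hαs, cl, Cu, hcl, hCu, hw⟩ := exists_weights hpos hmono hlim hδ hsq
  obtain ⟨F, c, hF, hFc, hm⟩ := exists_disc_function hα hαs
  have hc : RowBounded c := fun k => ⟨(hm k).1, by simpa using ((hm k).2 0).2⟩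
  have hlow : ∀ k : ℕ, 4 ≤ k → cl * g k ^ 2 ≤ ∑' j, ‖c k j‖ ^ 2 := fun k hk => by
    obtain ⟨n, hn⟩ := (hw k hk).1
    exact hn.trans ((hm k).2 n).1
  have hup : ∀ k : ℕ, 4 ≤ k → ∑' j, ‖c k j‖ ^ 2 ≤ Cu * g k ^ 2 := fun k hk => by
    obtain ⟨n, hn⟩ := (hw k hk).2
    exact ((hm k).2 n).2.trans hn
  have hgnat : ∀ {m n : ℕ}, 1 ≤ m → m ≤ n → g n ≤ g m := fun {m n} h1 h2 =>
    hmono (show (1 : ℝ) ≤ m by exact_mod_cast h1) (show (1 : ℝ) ≤ n by exact_mod_cast h1.trans h2)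
      (by exact_mod_cast h2)
  have hgpos : ∀ {m : ℕ}, 1 ≤ m → 0 < g m := fun {m} h1 => hpos m (by exact_mod_cast h1)
  have htail : ∀ m : ℕ, 4 ≤ m →
      ‖rowOp c hc - rowOp _ (hc.ite fun k => k < m)‖ ≤ 2 * (√Cu * g m) := by
    intro m hm4
    have hg := hgpos (by omega : 1 ≤ m)
    rw [rowOp_sub_ite]
    refine norm_rowOp_le _ (by positivity) fun k => ?_
    rw [mul_pow, Real.sq_sqrt hCu.le]
    by_cases hk : k < m
    · simp only [hk, not_true_eq_false, if_false, norm_zero, ne_eq, OfNat.ofNat_ne_zero,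
        not_false_eq_true, zero_pow, tsum_zero]
      positivity
    · simp only [hk, not_false_eq_true, if_true]
      refine (hup k (by omega)).trans (mul_le_mul_of_nonneg_left ?_ hCu.le)
      exact pow_le_pow_left₀ (hgpos (by omega)).le (hgnat (by omega) (by omega)) 2
  have hcompact : IsCompactOperator (rowOp c hc) := by
    have hlim' : Tendsto (fun m : ℕ => 2 * (√Cu * g m)) atTop (nhds 0) := by
      simpa using ((hlim.comp tendsto_natCast_atTop_atTop).const_mul (√Cu)).const_mul 2
    have ht : Tendsto (fun m : ℕ => rowOp _ (hc.ite fun k => k < m)) atTop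
        (nhds (rowOp c hc)) := by
      rw [tendsto_iff_norm_sub_tendsto_zero]
      refine squeeze_zero' (Eventually.of_forall fun _ => norm_nonneg _) ?_ hlim'
      filter_upwards [eventually_ge_atTop 4] with m hm4
      rw [norm_sub_rev]
      exact htail m hm4
    refine isCompactOperator_of_tendsto ht (Eventually.of_forall fun m => ?_)
    have := (finrank_range_rowOp_ite_lt hc m).1
    exact isCompactOperator_of_finiteDimensional_range _
  have hupper : ∀ n : ℕ, 5 ≤ n → approxNumber (rowOp c hc) n ≤ 2 * √Cu / δ * g n := by
    intro n hn
    obtain ⟨h1, h2⟩ := finrank_range_rowOp_ite_lt hc (n - 1)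
    refine (approxNumber_le _ _ h1 (by omega)).trans ((htail (n - 1) (by omega)).trans ?_)
    have h3 : δ * g ((n - 1 : ℕ) : ℝ) ≤ g n := by
      have h4 := hsq ((n - 1 : ℕ) : ℝ) (by exact_mod_cast (by omega : 1 ≤ n - 1))
      have h5 : n ≤ (n - 1) ^ 2 := by
        obtain ⟨m, rfl⟩ : ∃ m, n = m + 1 := ⟨n - 1, by omega⟩
        rw [Nat.add_sub_cancel]
        nlinarith
      have h6 := hgnat (by omega : 1 ≤ n) h5
      push_cast at h6
      exact h4.trans h6
    rw [div_mul_eq_mul_div, le_div_iff₀ hδ]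
    calc 2 * (√Cu * g ((n - 1 : ℕ) : ℝ)) * δ = 2 * √Cu * (δ * g ((n - 1 : ℕ) : ℝ)) := by ring
      _ ≤ 2 * √Cu * g n := mul_le_mul_of_nonneg_left h3 (by positivity)
  have hlower : ∀ n : ℕ, 2 ≤ n → √(cl / 120) * δ ^ 4 * g n ≤ approxNumber (rowOp c hc) n := by
    intro n hn
    have hn1 : 1 ≤ n := by omega
    obtain ⟨f, S, hS, hf⟩ := exists_logCoef_lower_bound hn1
    refine le_approxNumber _ hn1 f (fun a ha => (hf a).1 ha) fun a => ?_
    have h1 := (hf a).2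
    set x : H2 := ∑ i, a i • f i with hx
    have hg : 0 < g n := hgpos hn1
    have hgk : ∀ k ∈ S, (δ ^ 4 * g n) ^ 2 ≤ g k ^ 2 := by
      intro k hk
      refine pow_le_pow_left₀ (by positivity) ?_ 2
      have h2 := mul_pow_le_of_sq hδ hsq 4 n (by exact_mod_cast hn1)
      have h3 : k ≤ n ^ 2 ^ 4 := by
        refine (hS k hk).2.trans ?_
        calc 6000 * n ^ 3 ≤ n ^ 13 * n ^ 3 := by
              refine Nat.mul_le_mul_right _ (le_trans (by norm_num) (Nat.pow_le_pow_left hn 13))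
          _ = n ^ 2 ^ 4 := by ring
      have h4 := hgnat (by linarith [(hS k hk).1] : 1 ≤ k) h3
      push_cast at h4
      exact h2.trans h4
    have hsum := hc.hasSum_norm_sq x
    rw [← rowOp_apply hc] at hsum
    have h5 : cl * (δ ^ 4 * g n) ^ 2 * ∑ k ∈ S, ‖logCoef k x‖ ^ 2 ≤ ‖rowOp c hc x‖ ^ 2 := by
      rw [← hsum.tsum_eq, Finset.mul_sum]
      refine le_trans (Finset.sum_le_sum fun k hk => ?_) (hsum.summable.sum_le_tsum S fun k _ =>
        mul_nonneg (sq_nonneg _) (tsum_nonneg fun j => sq_nonneg _))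
      rw [mul_comm]
      refine mul_le_mul_of_nonneg_left ?_ (sq_nonneg _)
      exact (mul_le_mul_of_nonneg_left (hgk k hk) hcl.le).trans (hlow k (hS k hk).1)
    refine (sq_le_sq₀ (by positivity) (norm_nonneg _)).1 (le_trans ?_ h5)
    rw [mul_pow, mul_assoc (√(cl / 120)), mul_pow (√(cl / 120)), Real.sq_sqrt (by positivity)]
    have h6 := mul_le_mul_of_nonneg_left h1
      (by positivity : 0 ≤ cl / 120 * (δ ^ 4 * g n) ^ 2)
    refine h6.trans (le_of_eq (by ring))
  refine ⟨symbolCoef c, fun s => 3 / 2 - (3 : ℂ) ^ (-s) * F (2 ^ (-s)),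
    dsConvUnif_symbolCoef hc hFc, fun s hs => ?_, rowOp c hc, isCompOp_rowOp hc hF hFc, hcompact,
    √(cl / 120) * δ ^ 4, max (√(cl / 120) * δ ^ 4) (2 * √Cu / δ), by positivity,
    le_max_left _ _, 5, by norm_num, fun n hn => ⟨hlower n (by omega), ?_⟩⟩
  · have h1 := norm_three_cpow_mul_lt_one hF hs
    have h2 := (Complex.re_le_norm ((3 : ℂ) ^ (-s) * F (2 ^ (-s)))).trans_lt h1
    rw [Complex.sub_re]
    norm_num
    norm_num at h2
    linarith
  · exact (hupper n hn).trans
      (mul_le_mul_of_nonneg_right (le_max_right _ _) (hgpos (by omega)).le)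
end
end

section
/- Let H be a complex Hilbert space, let k₁,…,k_N be nonzero vectors in H, and let M > 0 be such that for every (a₁,…,a_N) ∈ ℂ^N there exists f ∈ H with ⟨f, k_j⟩ = a_j for all j and ‖f‖² ≤ M²·∑_{j=1}^N |a_j|²/‖k_j‖². Then for all complex numbers b₁,…,b_N one has ‖∑_{j=1}^N b_j k_j‖² ≥ M^{−2}·∑_{j=1}^N |b_j|²·‖k_j‖². -/
open scoped InnerProductSpace

/-- If every admissible target `a` can be interpolated by some `f` with
`⟨f, k j⟩ = a j` and `‖f‖² ≤ M² ∑ |a j|²/‖k j‖²`, then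
`‖∑ b j • k j‖² ≥ M⁻² ∑ |b j|² ‖k j‖²` for all scalars `b j`. -/
theorem stmt10 {H : Type*} [NormedAddCommGroup H] [InnerProductSpace ℂ H]
    [CompleteSpace H] (N : ℕ) (k : Fin N → H) (hk : ∀ j, k j ≠ 0)
    (M : ℝ) (hM : 0 < M)
    (h : ∀ a : Fin N → ℂ, ∃ f : H, (∀ j, ⟪f, k j⟫_ℂ = a j) ∧
      ‖f‖ ^ 2 ≤ M ^ 2 * ∑ j, ‖a j‖ ^ 2 / ‖k j‖ ^ 2)
    (b : Fin N → ℂ) :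
    M⁻¹ ^ 2 * ∑ j, ‖b j‖ ^ 2 * ‖k j‖ ^ 2 ≤ ‖∑ j, b j • k j‖ ^ 2 := by
  set S : ℝ := ∑ j, ‖b j‖ ^ 2 * ‖k j‖ ^ 2 with hS
  obtain ⟨f, hf, hfn⟩ := h fun j => star (b j) * ((‖k j‖ ^ 2 : ℝ) : ℂ)
  have hsum : ∑ j, ‖star (b j) * ((‖k j‖ ^ 2 : ℝ) : ℂ)‖ ^ 2 / ‖k j‖ ^ 2 = S := by
    refine Finset.sum_congr rfl fun j _ => ?_
    have hj : ‖k j‖ ≠ 0 := norm_ne_zero_iff.mpr (hk j)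
    rw [norm_mul, norm_star, Complex.norm_real, Real.norm_of_nonneg (by positivity)]
    field_simp
  have hinner : ⟪f, ∑ j, b j • k j⟫_ℂ = (S : ℂ) := by
    rw [inner_sum, hS, Complex.ofReal_sum]
    refine Finset.sum_congr rfl fun j _ => ?_
    rw [inner_smul_right, hf, ← mul_assoc, Complex.star_def, Complex.mul_conj']
    push_cast
    rfl
  have hS0 : 0 ≤ S := by positivity
  have hCS : S ≤ ‖f‖ * ‖∑ j, b j • k j‖ := by
    have := norm_inner_le_norm (𝕜 := ℂ) f (∑ j, b j • k j)
    rwa [hinner, Complex.norm_real, Real.norm_of_nonneg hS0] at this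
  rw [hsum] at hfn
  rcases hS0.eq_or_lt with h0 | hpos
  · rw [← h0, mul_zero]
    positivity
  have hsq : S * S ≤ S * (M ^ 2 * ‖∑ j, b j • k j‖ ^ 2) :=
    calc S * S = S ^ 2 := (sq S).symm
      _ ≤ (‖f‖ * ‖∑ j, b j • k j‖) ^ 2 := by gcongr
      _ = ‖f‖ ^ 2 * ‖∑ j, b j • k j‖ ^ 2 := mul_pow ..
      _ ≤ M ^ 2 * S * ‖∑ j, b j • k j‖ ^ 2 := by gcongr
      _ = S * (M ^ 2 * ‖∑ j, b j • k j‖ ^ 2) := by ring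
  rw [inv_pow, inv_mul_le_iff₀ (by positivity)]
  exact le_of_mul_le_mul_left hsq hpos
end

section
/- There exists an absolute constant C with the following property: if θ > 1/2, R > 0, μ is a finite nonnegative Borel measure on ℂ supported on the set {s : 1/2 < Re s ≤ θ, |Im s| ≤ R}, and K ≥ 0 is such that ∫ |h|² dμ ≤ K·‖h‖²_{H²(ℂ_{1/2})} for every h ∈ H²(ℂ_{1/2}), then ∫ |f|² dμ ≤ C·(R² + θ²)·K·‖f‖²_{ℋ²} for every f ∈ ℋ². -/
open Complex Filter MeasureTheory

noncomputable section

/-- `h` is analytic on `Re s > 1/2` and its squared `H²(ℂ_{1/2})` norm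
`sup_{σ>1/2} (1/2π) ∫ |h(σ+it)|² dt` is at most `B`. -/
def MemH2C (h : ℂ → ℂ) (B : ℝ) : Prop :=
  DifferentiableOn ℂ h {s : ℂ | 1 / 2 < s.re} ∧
    ∀ σ : ℝ, 1 / 2 < σ →
      (∫⁻ t : ℝ, (‖h (σ + t * Complex.I)‖₊ : ENNReal) ^ 2) ≤
        ENNReal.ofReal (2 * Real.pi * B)

theorem lorentz_integrable {a : ℝ} (ha : 0 < a) :
    Integrable fun t : ℝ => 1 / (a ^ 2 + t ^ 2) := by
  have h := (integrable_inv_one_add_sq.comp_mul_left' (inv_ne_zero ha.ne')).const_mul (a ^ 2)⁻¹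
  refine h.congr (Eventually.of_forall fun t => ?_)
  simp only
  field_simp

theorem integrable_cexp_neg_abs {a : ℝ} (ha : 0 < a) :
    Integrable fun v : ℝ => cexp (-(a * |v| : ℝ)) := by
  rw [← integrableOn_univ, ← Set.Iic_union_Ioi (a := (0 : ℝ)), integrableOn_union]
  constructor
  · refine (integrableOn_exp_mul_complex_Iic (a := (a : ℂ)) (by simpa) 0).congr_fun
      (fun v hv => ?_) measurableSet_Iic
    simp [abs_of_nonpos (Set.mem_Iic.1 hv)]
  · refine (integrableOn_exp_mul_complex_Ioi (a := -(a : ℂ)) (by simpa) 0).congr_fun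
      (fun v hv => ?_) measurableSet_Ioi
    simp [abs_of_pos (Set.mem_Ioi.1 hv)]

open FourierTransform in
theorem fourier_cexp_neg_abs {a : ℝ} (ha : 0 < a) (w : ℝ) :
    𝓕 (fun v : ℝ => cexp (-(2 * Real.pi * a * |v| : ℝ))) w
      = (a / Real.pi * (1 / (a ^ 2 + w ^ 2)) : ℝ) := by
  have hpi := Real.pi_pos
  have e1 : ∀ v ∈ Set.Iic (0 : ℝ), cexp ((-2 * Real.pi * v * w : ℝ) * I) •
      cexp (-(2 * Real.pi * a * |v| : ℝ)) = cexp ((2 * Real.pi * (a - w * I)) * v) := by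
    intro v hv
    rw [abs_of_nonpos (Set.mem_Iic.1 hv), smul_eq_mul, ← Complex.exp_add]
    push_cast
    congr 1
    ring
  have e2 : ∀ v ∈ Set.Ioi (0 : ℝ), cexp ((-2 * Real.pi * v * w : ℝ) * I) •
      cexp (-(2 * Real.pi * a * |v| : ℝ)) = cexp (-(2 * Real.pi * (a + w * I)) * v) := by
    intro v hv
    rw [abs_of_pos (Set.mem_Ioi.1 hv), smul_eq_mul, ← Complex.exp_add]
    push_cast
    congr 1
    ring
  have r1 : 0 < (2 * Real.pi * (a - w * I) : ℂ).re := by simp; positivity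
  have r2 : (-(2 * Real.pi * (a + w * I)) : ℂ).re < 0 := by simp; positivity
  rw [Real.fourier_real_eq_integral_exp_smul, ← intervalIntegral.integral_Iic_add_Ioi (b := 0),
    setIntegral_congr_fun measurableSet_Iic e1, setIntegral_congr_fun measurableSet_Ioi e2,
    integral_exp_mul_complex_Iic r1, integral_exp_mul_complex_Ioi r2]
  · have n1 : (a - w * I : ℂ) ≠ 0 := fun h => by
      have := congrArg Complex.re h; simp at this; exact ha.ne' this
    have n2 : (a + w * I : ℂ) ≠ 0 := fun h => by
      have := congrArg Complex.re h; simp at this; exact ha.ne' this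
    have n3 : (a ^ 2 + w ^ 2 : ℂ) = (a - w * I) * (a + w * I) := by
      ring_nf; simp
    have n4 : (Real.pi : ℂ) ≠ 0 := by exact_mod_cast hpi.ne'
    push_cast
    rw [n3]
    simp only [mul_zero, Complex.exp_zero]
    field_simp
    ring
  · exact (integrableOn_exp_mul_complex_Iic r1 0).congr_fun (fun v hv => (e1 v hv).symm)
      measurableSet_Iic
  · exact (integrableOn_exp_mul_complex_Ioi r2 0).congr_fun (fun v hv => (e2 v hv).symm)
      measurableSet_Ioi

open FourierTransform in
theorem integral_cexp_lorentz {a : ℝ} (ha : 0 < a) (ω : ℝ) :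
    ∫ t : ℝ, cexp ((ω * t : ℝ) * I) * (1 / (a ^ 2 + t ^ 2) : ℝ)
      = (Real.pi / a * Real.exp (-(a * |ω|)) : ℝ) := by
  have hpi := Real.pi_pos
  have hF := funext (fourier_cexp_neg_abs ha)
  have hi : Integrable (𝓕 (fun v : ℝ => cexp (-(2 * Real.pi * a * |v| : ℝ)))) := by
    rw [hF]
    exact ((lorentz_integrable ha).const_mul _).ofReal
  have h := congrFun (Continuous.fourierInv_fourier_eq (by fun_prop)
    (integrable_cexp_neg_abs (a := 2 * Real.pi * a) (by positivity)) hi) (ω / (2 * Real.pi))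
  rw [hF, Real.fourierInv_eq'] at h
  have hc : ∀ t : ℝ, cexp ((2 * Real.pi * inner ℝ t (ω / (2 * Real.pi)) : ℝ) * I) •
      ((a / Real.pi * (1 / (a ^ 2 + t ^ 2)) : ℝ) : ℂ) =
      (a / Real.pi : ℝ) * (cexp ((ω * t : ℝ) * I) * (1 / (a ^ 2 + t ^ 2) : ℝ)) := by
    intro t
    have hin : 2 * Real.pi * inner ℝ t (ω / (2 * Real.pi)) = ω * t := by
      simp only [RCLike.inner_apply, conj_trivial]
      field_simp
    rw [hin, smul_eq_mul, Complex.ofReal_mul (a / Real.pi)]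
    ring
  simp_rw [hc] at h
  rw [integral_const_mul] at h
  have hne : ((a / Real.pi : ℝ) : ℂ) ≠ 0 := by exact_mod_cast (by positivity : a / Real.pi ≠ 0)
  apply mul_left_cancel₀ hne
  rw [h, abs_div, abs_of_pos (by positivity : 0 < 2 * Real.pi),
    show 2 * Real.pi * a * (|ω| / (2 * Real.pi)) = a * |ω| by field_simp,
    ← Complex.ofReal_mul, show a / Real.pi * (Real.pi / a * Real.exp (-(a * |ω|)))
      = Real.exp (-(a * |ω|)) by field_simp]
  push_cast
  rfl

theorem integrable_sq_norm_exp_sum {ι : Type*} {a : ℝ} (ha : 0 < a) (s : Finset ι) (c : ι → ℂ)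
    (l : ι → ℝ) :
    Integrable fun t : ℝ =>
      ‖∑ i ∈ s, c i * cexp ((-l i * t : ℝ) * I)‖ ^ 2 * (1 / (a ^ 2 + t ^ 2)) := by
  refine (lorentz_integrable ha).bdd_mul (c := (∑ i ∈ s, ‖c i‖) ^ 2)
    (Continuous.aestronglyMeasurable (by fun_prop)) (Eventually.of_forall fun t => ?_)
  rw [norm_pow, norm_norm]
  gcongr
  refine (norm_sum_le _ _).trans_eq ?_
  simp [Complex.norm_exp_ofReal_mul_I, -ofReal_mul, -ofReal_neg]

theorem integral_sq_norm_exp_sum_le {ι : Type*} {a : ℝ} (ha : 0 < a) (s : Finset ι) (c : ι → ℂ)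
    (l : ι → ℝ) :
    ∫ t : ℝ, ‖∑ i ∈ s, c i * cexp ((-l i * t : ℝ) * I)‖ ^ 2 * (1 / (a ^ 2 + t ^ 2)) ≤
      Real.pi / a * ∑ i ∈ s, ∑ j ∈ s, ‖c i‖ * ‖c j‖ * Real.exp (-(a * |l i - l j|)) := by
  have hpi := Real.pi_pos
  have hexp : ∀ t : ℝ,
      ((‖∑ i ∈ s, c i * cexp ((-l i * t : ℝ) * I)‖ ^ 2 * (1 / (a ^ 2 + t ^ 2)) : ℝ) : ℂ) =
      ∑ i ∈ s, ∑ j ∈ s, c i * (starRingEnd ℂ) (c j) *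
        (cexp (((l j - l i) * t : ℝ) * I) * (1 / (a ^ 2 + t ^ 2) : ℝ)) := by
    intro t
    rw [Complex.ofReal_mul, Complex.ofReal_pow, ← Complex.mul_conj', map_sum, Finset.sum_mul_sum,
      Finset.sum_mul]
    refine Finset.sum_congr rfl fun i _ => ?_
    rw [Finset.sum_mul]
    refine Finset.sum_congr rfl fun j _ => ?_
    rw [map_mul, ← Complex.exp_conj, map_mul, Complex.conj_I, Complex.conj_ofReal,
      show ((l j - l i) * t : ℝ) * I = (-l i * t : ℝ) * I + (-l j * t : ℝ) * -I by
        push_cast; ring, Complex.exp_add]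
    ring
  have hint : ∀ ω : ℝ, Integrable fun t : ℝ => cexp ((ω * t : ℝ) * I) *
      ((1 / (a ^ 2 + t ^ 2) : ℝ) : ℂ) := fun ω =>
    (lorentz_integrable ha).ofReal.bdd_mul (c := 1)
      (Continuous.aestronglyMeasurable (by fun_prop))
      (Eventually.of_forall fun t => (Complex.norm_exp_ofReal_mul_I _).le)
  have key : ((∫ t : ℝ, ‖∑ i ∈ s, c i * cexp ((-l i * t : ℝ) * I)‖ ^ 2 *
      (1 / (a ^ 2 + t ^ 2)) : ℝ) : ℂ) = ∑ i ∈ s, ∑ j ∈ s, c i * (starRingEnd ℂ) (c j) *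
        (Real.pi / a * Real.exp (-(a * |l j - l i|)) : ℝ) := by
    rw [← integral_complex_ofReal]
    simp_rw [hexp]
    rw [integral_finsetSum _ fun i _ => integrable_finsetSum _ fun j _ => (hint _).const_mul _]
    refine Finset.sum_congr rfl fun i _ => ?_
    rw [integral_finsetSum _ fun j _ => (hint _).const_mul _]
    refine Finset.sum_congr rfl fun j _ => ?_
    rw [integral_const_mul, integral_cexp_lorentz ha]
  refine (le_abs_self _).trans ?_
  rw [← Real.norm_eq_abs, ← Complex.norm_real, key, Finset.mul_sum]
  refine (norm_sum_le _ _).trans (Finset.sum_le_sum fun i _ => ?_)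
  rw [Finset.mul_sum]
  refine (norm_sum_le _ _).trans (Finset.sum_le_sum fun j _ => le_of_eq ?_)
  rw [norm_mul, norm_mul, RCLike.norm_conj, Complex.norm_real, Real.norm_of_nonneg (by positivity),
    abs_sub_comm]
  ring

theorem schur_row_bound (m N : ℕ) (hm : 0 < m) :
    ∑ n ∈ Finset.range N, 1 / (max (m : ℝ) (n + 1)) * √(m / (n + 1)) ≤ 4 := by
  have hm' : (0 : ℝ) < m := by exact_mod_cast hm
  have step : ∀ N : ℕ, ∑ n ∈ Finset.range N, 1 / (max (m : ℝ) (n + 1)) * √(m / (n + 1)) ≤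
      if N ≤ m then 2 * √(N / m) else 4 - 2 * √(m / N) := by
    intro N
    induction N with
    | zero => simp
    | succ N ih =>
      rw [Finset.sum_range_succ]
      have hN : (0 : ℝ) < N + 1 := by positivity
      obtain ⟨x, hx, hxx⟩ : ∃ x : ℝ, 0 < x ∧ x ^ 2 = N + 1 := ⟨√(N + 1), by positivity,
        Real.sq_sqrt hN.le⟩
      obtain ⟨y, hy, hyy⟩ : ∃ y : ℝ, 0 ≤ y ∧ y ^ 2 = N := ⟨√N, by positivity,
        Real.sq_sqrt (Nat.cast_nonneg N)⟩
      obtain ⟨z, hz, hzz⟩ : ∃ z : ℝ, 0 < z ∧ z ^ 2 = m := ⟨√m, by positivity,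
        Real.sq_sqrt hm'.le⟩
      have hyx : y ≤ x := by nlinarith
      rcases Nat.lt_or_ge N m with h | h
      · rw [if_pos h.le] at ih
        rw [if_pos (Nat.succ_le_of_lt h)]
        have hmax : max (m : ℝ) (N + 1) = m := max_eq_left (by exact_mod_cast h)
        rw [hmax]
        push_cast
        rw [← hyy, ← hzz, ← div_pow, Real.sqrt_sq (by positivity)] at ih
        rw [← hxx, ← hzz, ← div_pow, ← div_pow, Real.sqrt_sq (by positivity),
          Real.sqrt_sq (by positivity)]
        refine (add_le_add_left ih _).trans ?_
        have : 2 * (x / z) - (2 * (y / z) + 1 / z ^ 2 * (z / x)) = (x - y) ^ 2 / (x * z) := by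
          field_simp
          nlinarith
        have h2 : 0 ≤ (x - y) ^ 2 / (x * z) := by positivity
        linarith
      · have hy0 : 0 < y := by
          have : (0 : ℝ) < N := by exact_mod_cast hm.trans_le h
          nlinarith
        have ih' : ∑ n ∈ Finset.range N, 1 / (max (m : ℝ) (n + 1)) * √(m / (n + 1)) ≤
            4 - 2 * √(m / N) := by
          split_ifs at ih with h'
          · have : N = m := le_antisymm h' h
            subst this
            rw [div_self hm'.ne'] at ih ⊢
            norm_num at ih ⊢
            linarith
          · exact ih
        rw [if_neg (by omega)]
        have hmax : max (m : ℝ) (N + 1) = N + 1 :=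
          max_eq_right (by exact_mod_cast h.trans (Nat.le_succ N))
        rw [hmax]
        push_cast
        rw [← hyy, ← hzz, ← div_pow, Real.sqrt_sq (by positivity)] at ih'
        rw [← hxx, ← hzz, ← div_pow, Real.sqrt_sq (by positivity)]
        refine (add_le_add_left ih' _).trans ?_
        have h1 : (4 - 2 * (z / x)) - (4 - 2 * (z / y) + 1 / x ^ 2 * (z / x)) =
            z * (2 * x ^ 2 * (x - y) - y) / (x ^ 3 * y) := by
          field_simp
          ring
        have h2 : (x - y) * (x + y) = 1 := by nlinarith
        have h4 : 0 ≤ x - y := by linarith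
        have h3 : y ≤ 2 * x ^ 2 * (x - y) := by
          have : 2 * x ^ 2 * (x - y) - y = (x - y) * (2 * x ^ 2 - y * (x + y)) := by
            linear_combination y * h2
          have : 0 ≤ (x - y) * (2 * x ^ 2 - y * (x + y)) := mul_nonneg h4 (by nlinarith)
          linarith
        have : 0 ≤ z * (2 * x ^ 2 * (x - y) - y) / (x ^ 3 * y) := by
          apply div_nonneg (mul_nonneg hz.le (by linarith)) (by positivity)
        linarith
  refine (step N).trans ?_
  split_ifs with h
  · have : √((N : ℝ) / m) ≤ 1 := by
      refine Real.sqrt_le_one.mpr ((div_le_one hm').mpr ?_)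
      exact_mod_cast h
    linarith
  · have := Real.sqrt_nonneg ((m : ℝ) / N)
    linarith

theorem sum_mul_div_max_le (a : ℕ → ℝ) (N : ℕ) :
    ∑ i ∈ Finset.range N, ∑ j ∈ Finset.range N, a i * a j * (1 / max ((i : ℝ) + 1) (j + 1)) ≤
      4 * ∑ i ∈ Finset.range N, a i ^ 2 := by
  have hsym : ∀ i j : ℕ, a i * a j * (1 / max ((i : ℝ) + 1) (j + 1)) ≤
      1 / 2 * (a i ^ 2 * (1 / max ((i : ℝ) + 1) (j + 1) * √((i + 1) / (j + 1)))) +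
      1 / 2 * (a j ^ 2 * (1 / max ((j : ℝ) + 1) (i + 1) * √((j + 1) / (i + 1)))) := by
    intro i j
    rw [max_comm ((j : ℝ) + 1)]
    have hM : 0 ≤ 1 / max ((i : ℝ) + 1) (j + 1) := by positivity
    have hr : (((i : ℝ) + 1) / (j + 1)) * ((j + 1) / (i + 1)) = 1 := by field_simp
    have h1 : √(((i : ℝ) + 1) / (j + 1)) * √((j + 1) / (i + 1)) = 1 := by
      rw [← Real.sqrt_mul (by positivity), hr, Real.sqrt_one]
    set p := √(((i : ℝ) + 1) / (j + 1))
    set q := √(((j : ℝ) + 1) / (i + 1))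
    have hp : 0 ≤ p := Real.sqrt_nonneg _
    have hq : 0 ≤ q := Real.sqrt_nonneg _
    have h2 : 2 * (a i * a j) ≤ a i ^ 2 * p + a j ^ 2 * q := by
      have hp0 : 0 < p := lt_of_le_of_ne hp fun h => by rw [← h] at h1; simp at h1
      have : 0 ≤ q * (a i * p - a j) ^ 2 := by positivity
      have e : q * (a i * p - a j) ^ 2 = a i ^ 2 * p + a j ^ 2 * q - 2 * (a i * a j) := by
        linear_combination (a i ^ 2 * p - 2 * a i * a j) * h1
      linarith
    nlinarith
  have hrow : ∀ i : ℕ, ∑ j ∈ Finset.range N,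
      1 / 2 * (a i ^ 2 * (1 / max ((i : ℝ) + 1) (j + 1) * √((i + 1) / (j + 1)))) ≤
      2 * a i ^ 2 := by
    intro i
    have := schur_row_bound (i + 1) N i.succ_pos
    push_cast at this
    rw [← Finset.mul_sum, ← Finset.mul_sum]
    nlinarith [sq_nonneg (a i)]
  calc _ ≤ ∑ i ∈ Finset.range N, ∑ j ∈ Finset.range N, _ :=
        Finset.sum_le_sum fun i _ => Finset.sum_le_sum fun j _ => hsym i j
    _ = (∑ i ∈ Finset.range N, ∑ j ∈ Finset.range N,
          1 / 2 * (a i ^ 2 * (1 / max ((i : ℝ) + 1) (j + 1) * √((i + 1) / (j + 1))))) +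
        ∑ j ∈ Finset.range N, ∑ i ∈ Finset.range N,
          1 / 2 * (a j ^ 2 * (1 / max ((j : ℝ) + 1) (i + 1) * √((j + 1) / (i + 1)))) := by
        simp_rw [Finset.sum_add_distrib]
        congr 1
        exact Finset.sum_comm
    _ ≤ ∑ i ∈ Finset.range N, 2 * a i ^ 2 + ∑ i ∈ Finset.range N, 2 * a i ^ 2 :=
        add_le_add (Finset.sum_le_sum fun i _ => hrow i) (Finset.sum_le_sum fun i _ => hrow i)
    _ = _ := by rw [← Finset.mul_sum]; ring

theorem sum_sq_norm_le (x : H2) (N : ℕ) :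
    ∑ n ∈ Finset.range N, ‖x n.succPNat‖ ^ 2 ≤ ‖x‖ ^ 2 := by
  have h := lp.sum_rpow_le_norm_rpow (p := 2) (by norm_num) x
    ((Finset.range N).map ⟨Nat.succPNat, Nat.succPNat_injective⟩)
  simpa using h

theorem norm_H2series_term (x : H2) (n : ℕ+) (s : ℂ) :
    ‖x n * (n : ℂ) ^ (-s)‖ = ‖x n‖ * (n : ℝ) ^ (-s.re) := by
  rw [norm_mul, Complex.norm_natCast_cpow_of_pos n.pos, Complex.neg_re]

theorem summable_H2_rpow (x : H2) {σ : ℝ} (hσ : 1 / 2 < σ) :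
    Summable fun n : ℕ+ => ‖x n‖ * (n : ℝ) ^ (-σ) := by
  have h1 : Summable fun n : ℕ+ => ‖x n‖ ^ 2 := by
    simpa using (lp.memℓp x).summable (by norm_num)
  have h2 : Summable fun n : ℕ+ => ((n : ℝ) ^ (-σ)) ^ 2 := by
    have h := (Real.summable_nat_rpow.2 (by linarith : -(2 * σ) < -1)).comp_injective
      PNat.coe_injective
    refine h.congr fun n => ?_
    rw [Function.comp_apply, ← Real.rpow_mul_natCast (Nat.cast_nonneg _)]
    congr 1
    push_cast
    ring
  refine (h1.add h2).of_nonneg_of_le (fun n => by positivity) fun n => ?_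
  nlinarith [two_mul_le_add_sq ‖x n‖ ((n : ℝ) ^ (-σ)), sq_nonneg (‖x n‖),
    sq_nonneg ((n : ℝ) ^ (-σ))]

theorem differentiableOn_H2series (x : H2) :
    DifferentiableOn ℂ (H2series x) {s : ℂ | 1 / 2 < s.re} := by
  intro s hs
  obtain ⟨σ, h1, h2⟩ := exists_between (show (1 / 2 : ℝ) < s.re from hs)
  have hopen : IsOpen {w : ℂ | σ < w.re} := isOpen_lt continuous_const Complex.continuous_re
  have h : DifferentiableOn ℂ (H2series x) {w : ℂ | σ < w.re} := by
    refine Complex.differentiableOn_tsum_of_summable_norm (summable_H2_rpow x h1) (fun n => ?_)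
      hopen fun n w hw => ?_
    · have : (n : ℂ) ≠ 0 := by exact_mod_cast n.ne_zero
      exact ((differentiable_id.neg.const_cpow (Or.inl this)).const_mul _).differentiableOn
    · rw [norm_H2series_term]
      have : (1 : ℝ) ≤ n := by exact_mod_cast (one_le : 1 ≤ n)
      have hw' : σ < w.re := hw
      gcongr
  exact (h.differentiableAt (hopen.mem_nhds h2)).differentiableWithinAt

theorem tendsto_partial_sum_H2series (x : H2) {s : ℂ} (hs : 1 / 2 < s.re) :
    Tendsto (fun N => ∑ n ∈ Finset.range N, x n.succPNat * ((n : ℂ) + 1) ^ (-s)) atTop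
      (nhds (H2series x s)) := by
  have hsum : Summable fun n : ℕ+ => x n * (n : ℂ) ^ (-s) :=
    Summable.of_norm (by simpa only [norm_H2series_term] using summable_H2_rpow x hs)
  have h := (Equiv.pnatEquivNat.symm.hasSum_iff.2 hsum.hasSum).tendsto_sum_nat
  refine h.congr fun N => Finset.sum_congr rfl fun n _ => ?_
  simp

theorem rpow_mul_exp_log_le {σ p q : ℝ} (hσ : 1 / 2 < σ) (hp : 1 ≤ p) (hq : 1 ≤ q) :
    p ^ (-σ) * q ^ (-σ) * Real.exp (-(σ * |Real.log p - Real.log q|)) ≤ 1 / max p q := by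
  have hp0 : 0 < p := by linarith
  have hq0 : 0 < q := by linarith
  wlog h : q ≤ p generalizing p q
  · have := this hq hp hq0 hp0 (le_of_not_ge h)
    rwa [mul_comm (q ^ (-σ)), abs_sub_comm, max_comm] at this
  have hl : Real.log q ≤ Real.log p := Real.log_le_log hq0 h
  have hl0 : 0 ≤ Real.log p := Real.log_nonneg hp
  rw [max_eq_left h, abs_of_nonneg (by linarith), Real.rpow_def_of_pos hp0,
    Real.rpow_def_of_pos hq0, ← Real.exp_add, ← Real.exp_add, one_div, ← Real.exp_log hp0,
    ← Real.exp_neg, Real.log_exp]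
  apply Real.exp_le_exp.2
  nlinarith

theorem natCast_add_one_cpow_eq (n : ℕ) (σ t : ℝ) :
    ((n : ℂ) + 1) ^ (-(σ + t * I)) = (((n : ℝ) + 1) ^ (-σ) : ℝ) *
      cexp ((-Real.log (n + 1) * t : ℝ) * I) := by
  have h : (0 : ℝ) < n + 1 := by positivity
  have h' : (n : ℂ) + 1 = ((n + 1 : ℝ) : ℂ) := by push_cast; rfl
  rw [h', Complex.cpow_def_of_ne_zero (by exact_mod_cast h.ne'), ← Complex.ofReal_log h.le,
    Real.rpow_def_of_pos h, Complex.ofReal_exp, ← Complex.exp_add]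
  congr 1
  push_cast
  ring

theorem lintegral_partial_sum_le (x : H2) {σ : ℝ} (hσ : 1 / 2 < σ) (N : ℕ) :
    ∫⁻ t : ℝ, (‖(∑ n ∈ Finset.range N, x n.succPNat * ((n : ℂ) + 1) ^ (-(σ + t * I))) /
      (σ + t * I)‖₊ : ENNReal) ^ 2 ≤ ENNReal.ofReal (2 * Real.pi * (4 * ‖x‖ ^ 2)) := by
  have hpi := Real.pi_pos
  have hσ0 : 0 < σ := by linarith
  set c : ℕ → ℂ := fun n => x n.succPNat * (((n : ℝ) + 1) ^ (-σ) : ℝ)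
  set l : ℕ → ℝ := fun n => Real.log (n + 1)
  have hpt : ∀ t : ℝ, (‖(∑ n ∈ Finset.range N, x n.succPNat *
      ((n : ℂ) + 1) ^ (-(σ + t * I))) / (σ + t * I)‖₊ : ENNReal) ^ 2 =
      ENNReal.ofReal (‖∑ i ∈ Finset.range N, c i * cexp ((-l i * t : ℝ) * I)‖ ^ 2 *
        (1 / (σ ^ 2 + t ^ 2))) := by
    intro t
    rw [← enorm_eq_nnnorm, ← ofReal_norm, ← ENNReal.ofReal_pow (norm_nonneg _), norm_div,
      div_pow, Complex.sq_norm (σ + t * I), Complex.normSq_add_mul_I, div_eq_mul_one_div]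
    simp_rw [natCast_add_one_cpow_eq, ← mul_assoc]
    rfl
  simp_rw [hpt]
  rw [← ofReal_integral_eq_lintegral_ofReal (integrable_sq_norm_exp_sum hσ0 _ c l)
    (Eventually.of_forall fun t => by positivity)]
  apply ENNReal.ofReal_le_ofReal
  refine (integral_sq_norm_exp_sum_le hσ0 _ c l).trans ?_
  have hS : ∑ i ∈ Finset.range N, ∑ j ∈ Finset.range N,
      ‖c i‖ * ‖c j‖ * Real.exp (-(σ * |l i - l j|)) ≤ 4 * ‖x‖ ^ 2 := by
    calc _ ≤ ∑ i ∈ Finset.range N, ∑ j ∈ Finset.range N,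
          ‖x i.succPNat‖ * ‖x j.succPNat‖ * (1 / max ((i : ℝ) + 1) (j + 1)) := by
          refine Finset.sum_le_sum fun i _ => Finset.sum_le_sum fun j _ => ?_
          have h := rpow_mul_exp_log_le hσ (p := (i : ℝ) + 1) (q := (j : ℝ) + 1) (by simp)
            (by simp)
          have hn : ∀ n, ‖c n‖ = ‖x n.succPNat‖ * ((n : ℝ) + 1) ^ (-σ) := fun n => by
            rw [norm_mul, Complex.norm_real, Real.norm_of_nonneg (by positivity)]
          rw [hn, hn]
          refine le_trans (le_of_eq ?_) (mul_le_mul_of_nonneg_left h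
            (by positivity : 0 ≤ ‖x i.succPNat‖ * ‖x j.succPNat‖))
          ring
      _ ≤ 4 * ∑ i ∈ Finset.range N, ‖x i.succPNat‖ ^ 2 :=
          sum_mul_div_max_le (fun n => ‖x n.succPNat‖) N
      _ ≤ _ := by gcongr; exact sum_sq_norm_le x N
  have hσ2 : Real.pi / σ ≤ 2 * Real.pi := by
    rw [div_le_iff₀ hσ0]
    nlinarith
  exact mul_le_mul hσ2 hS (by positivity) (by positivity)

theorem memH2C_H2series_div (x : H2) : MemH2C (fun s => H2series x s / s) (4 * ‖x‖ ^ 2) := by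
  refine ⟨(differentiableOn_H2series x).div differentiableOn_id fun s hs h => ?_, fun σ hσ => ?_⟩
  · have hs' : (1 / 2 : ℝ) < s.re := hs
    rw [h, Complex.zero_re] at hs'
    norm_num at hs'
  · have hlim : ∀ t : ℝ, Tendsto (fun N => (‖(∑ n ∈ Finset.range N, x n.succPNat *
        ((n : ℂ) + 1) ^ (-(σ + t * I))) / (σ + t * I)‖₊ : ENNReal) ^ 2) atTop
        (nhds ((‖H2series x (σ + t * I) / (σ + t * I)‖₊ : ENNReal) ^ 2)) := by
      intro t
      have h := (tendsto_partial_sum_H2series x (s := σ + t * I) (by simpa using hσ)).div_const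
        (σ + t * I)
      exact ((ENNReal.continuous_pow 2).tendsto _).comp (ENNReal.tendsto_coe.2 h.nnnorm)
    simp_rw [← fun t => (hlim t).liminf_eq]
    refine (lintegral_liminf_le' fun N => ?_).trans ?_
    · refine Measurable.aemeasurable (Measurable.pow_const (Measurable.coe_nnreal_ennreal
        (Measurable.nnnorm (Measurable.div (Finset.measurable_fun_sum _ fun n _ => ?_) ?_))) 2)
      · simp_rw [natCast_add_one_cpow_eq]
        fun_prop
      · fun_prop
    · exact liminf_le_of_frequently_le'
        (Frequently.of_forall fun N => lintegral_partial_sum_le x hσ N)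

theorem stmt11 :
    ∃ C : ℝ, 0 < C ∧
      ∀ (θ R K : ℝ) (μ : Measure ℂ), 1 / 2 < θ → 0 < R → 0 ≤ K →
        IsFiniteMeasure μ →
        μ {s : ℂ | ¬(1 / 2 < s.re ∧ s.re ≤ θ ∧ |s.im| ≤ R)} = 0 →
        (∀ (h : ℂ → ℂ) (B : ℝ), MemH2C h B →
          ∫⁻ s, (‖h s‖₊ : ENNReal) ^ 2 ∂μ ≤ ENNReal.ofReal (K * B)) →
        ∀ f : H2, ∫⁻ s, (‖H2series f s‖₊ : ENNReal) ^ 2 ∂μ ≤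
          ENNReal.ofReal (C * (R ^ 2 + θ ^ 2) * K * ‖f‖ ^ 2) := by
  refine ⟨4, by norm_num, fun θ R K μ hθ hR hK _ hμ hemb f => ?_⟩
  have hle : ∀ᵐ s ∂μ, (‖H2series f s‖₊ : ENNReal) ^ 2 ≤
      ENNReal.ofReal (R ^ 2 + θ ^ 2) * (‖H2series f s / s‖₊ : ENNReal) ^ 2 := by
    filter_upwards [ae_iff.2 hμ] with s ⟨h1, h2, h3⟩
    have hs : s ≠ 0 := fun h => by
      rw [h, Complex.zero_re] at h1
      norm_num at h1
    simp only [← enorm_eq_nnnorm, ← ofReal_norm]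
    rw [← ENNReal.ofReal_pow (norm_nonneg _), ← ENNReal.ofReal_pow (norm_nonneg _),
      ← ENNReal.ofReal_mul (by positivity), norm_div, div_pow]
    apply ENNReal.ofReal_le_ofReal
    have hs2 : 0 < ‖s‖ ^ 2 := by positivity
    rw [mul_div_assoc', le_div_iff₀ hs2, mul_comm]
    gcongr
    rw [Complex.sq_norm, Complex.normSq_apply]
    nlinarith [abs_le.1 h3]
  calc _ ≤ ∫⁻ s, ENNReal.ofReal (R ^ 2 + θ ^ 2) * (‖H2series f s / s‖₊ : ENNReal) ^ 2 ∂μ :=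
        lintegral_mono_ae hle
    _ = ENNReal.ofReal (R ^ 2 + θ ^ 2) * ∫⁻ s, (‖H2series f s / s‖₊ : ENNReal) ^ 2 ∂μ :=
        lintegral_const_mul' _ _ ENNReal.ofReal_ne_top
    _ ≤ ENNReal.ofReal (R ^ 2 + θ ^ 2) * ENNReal.ofReal (K * (4 * ‖f‖ ^ 2)) := by
        gcongr
        exact hemb _ _ (memH2C_H2series_div f)
    _ = _ := by
        rw [← ENNReal.ofReal_mul (by positivity)]
        congr 1
        ring
end
end
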